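/- arXiv:1712.04889 — 4 statements merged into one kernel-verified Lean document; each statement's English description precedes it below -/
import Mathlib

section
/- Let N∈ℕ, d>2, c₁>0, and let ξ:(ℤ/N)⁴→ℝ satisfy, with |·| the circular distance on ℤ/N, both |ξ(p,α,β,q)| ≤ c₁² max{(|p−β|+|α−q|+1)^{−d}, (|p−q|+|α−β|+1)^{−d}} and |ξ(p,α,β,q)| ≤ c₁²(1+|p−q|)^{−d} for all p,α,β,q. Define S:ℂ^{N×N}→ℂ^{N×N} by S(M)_{pq} := N^{−1}Σ_{α,β} ξ(p,α,β,q) M_{αβ}. Then there is a constant c>0 depending only on c₁ and d such that for every A∈ℂ^{N×N}: (1) ‖S(A)‖_{d−1} ≤ c|A|_∞; (2) ‖S(A)‖_{ℓ^p→ℓ^p} ≤ c|A|_∞ for every p∈[1,∞]; (3) ‖S(A)‖_d ≤ c‖A‖_{d−1}; (4) ‖S(A)‖_{d−1/2} ≤ c‖A‖. -/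
/-- Circular distance on `ℤ/N` (represented by `Fin N`). -/
def cdist {N : ℕ} (i j : Fin N) : ℕ :=
  min ((i : ℤ) - (j : ℤ)).natAbs (N - ((i : ℤ) - (j : ℤ)).natAbs)

/-- The weighted sup-norm `‖A‖_β := sup_{i,j} |A_{ij}| (1+|i−j|)^β`, with circular distance. -/
noncomputable def normDecayCirc {N : ℕ} (β : ℝ) (A : Matrix (Fin N) (Fin N) ℂ) : ℝ :=
  Finset.fold max 0
    (fun p : Fin N × Fin N => ‖A p.1 p.2‖ * (1 + (cdist p.1 p.2 : ℝ)) ^ β) Finset.univ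

/-- `|A|_∞ := max_{i,j} |A_{ij}|`. -/
noncomputable def entryMax {N : ℕ} (A : Matrix (Fin N) (Fin N) ℂ) : ℝ :=
  Finset.fold max 0 (fun p : Fin N × Fin N => ‖A p.1 p.2‖) Finset.univ

/-- The `ℓ²→ℓ²` operator norm of a complex `N × N` matrix. -/
noncomputable def l2OpNorm {N : ℕ} (A : Matrix (Fin N) (Fin N) ℂ) : ℝ :=
  ‖LinearMap.toContinuousLinearMap (Matrix.toEuclideanLin A)‖

/-- The `ℓᵖ→ℓᵖ` operator norm of a complex `N × N` matrix. -/
noncomputable def lpOpNorm (p : ENNReal) [Fact (1 ≤ p)] {N : ℕ}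
    (A : Matrix (Fin N) (Fin N) ℂ) : ℝ :=
  ‖LinearMap.toContinuousLinearMap
    (((WithLp.linearEquiv p ℂ (Fin N → ℂ)).symm.toLinearMap.comp A.mulVecLin).comp
      (WithLp.linearEquiv p ℂ (Fin N → ℂ)).toLinearMap)‖

/-- The map `S(M)_{pq} := N^{−1} Σ_{α,β} ξ(p,α,β,q) M_{αβ}`. -/
noncomputable def SmapXi {N : ℕ} (ξ : Fin N → Fin N → Fin N → Fin N → ℝ)
    (M : Matrix (Fin N) (Fin N) ℂ) : Matrix (Fin N) (Fin N) ℂ :=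
  Matrix.of fun p q => (N : ℂ)⁻¹ * ∑ a, ∑ b, (ξ p a b q : ℂ) * M a b


theorem fold_le {N : ℕ} (f : Fin N × Fin N → ℝ) (M : ℝ) (hM : 0 ≤ M) (h : ∀ i j, f (i, j) ≤ M) :
    Finset.fold max 0 f Finset.univ ≤ M := by
  rw [Finset.fold_max_le]
  exact ⟨hM, fun x _ => h x.1 x.2⟩

theorem le_fold {N : ℕ} (f : Fin N × Fin N → ℝ) (i j : Fin N) :
    f (i, j) ≤ Finset.fold max 0 f Finset.univ := by
  rw [Finset.le_fold_max]
  exact Or.inr ⟨(i, j), Finset.mem_univ _, le_rfl⟩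

theorem fold_nonneg {N : ℕ} (f : Fin N × Fin N → ℝ) :
    0 ≤ Finset.fold max 0 f Finset.univ := by
  rw [Finset.le_fold_max]
  exact Or.inl le_rfl

theorem cdist_comm' {N : ℕ} (i j : Fin N) : cdist i j = cdist j i := by
  unfold cdist; omega

theorem cdist_lt {N : ℕ} (i j : Fin N) : cdist i j + 1 ≤ N := by
  unfold cdist; omega

theorem cdist_add {N : ℕ} [NeZero N] (j t : Fin N) :
    cdist (j + t) j = min (t : ℕ) (N - t) := by
  have h : ((j + t : Fin N) : ℕ) = if (j : ℕ) + t < N then (j : ℕ) + t else (j : ℕ) + t - N := by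
    rw [Fin.val_add]
    split_ifs with h
    · exact Nat.mod_eq_of_lt h
    · rw [Nat.mod_eq_sub_mod (by omega), Nat.mod_eq_of_lt (by omega)]
  unfold cdist
  rw [h]
  split_ifs <;> omega

theorem sum_min_le (N : ℕ) (f : ℕ → ℝ) (hf : ∀ k, 0 ≤ f k) (C : ℝ)
    (hC : ∀ n, ∑ k ∈ Finset.range n, f k ≤ C) :
    ∑ t : Fin N, f (min (t : ℕ) (N - t)) ≤ 2 * C := by
  rw [Fin.sum_univ_eq_sum_range (fun t => f (min t (N - t))) N]
  calc _ ≤ ∑ t ∈ Finset.range N, (f t + f (N - 1 - t + 1)) := by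
        apply Finset.sum_le_sum
        intro t ht
        rw [Finset.mem_range] at ht
        have e : N - 1 - t + 1 = N - t := by omega
        rw [e]
        rcases min_choice t (N - t) with h | h <;> rw [h]
        · linarith [hf (N - t)]
        · linarith [hf t]
    _ = ∑ t ∈ Finset.range N, f t + ∑ t ∈ Finset.range N, f (t + 1) := by
        rw [Finset.sum_add_distrib, Finset.sum_range_reflect (fun t => f (t + 1)) N]
    _ ≤ C + C := by
        apply add_le_add (hC N)
        have := hC (N + 1)
        rw [Finset.sum_range_succ'] at this
        linarith [hf 0]
    _ = _ := by ring

theorem sum_cdist_le {N : ℕ} (f : ℕ → ℝ) (hf : ∀ k, 0 ≤ f k) (C : ℝ)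
    (hC : ∀ n, ∑ k ∈ Finset.range n, f k ≤ C) (j : Fin N) :
    ∑ i : Fin N, f (cdist i j) ≤ 2 * C := by
  haveI : NeZero N := ⟨by have := j.2; omega⟩
  rw [← Equiv.sum_comp (Equiv.addLeft j)]
  simp only [Equiv.coe_addLeft, cdist_add]
  exact sum_min_le N f hf C hC

/-- constant for the tail sums -/
noncomputable def KK (s : ℝ) : ℝ := (1 - (2 : ℝ) ^ (-(s - 1)))⁻¹

theorem KK_pos {s : ℝ} (hs : 1 < s) : 0 < KK s := by
  unfold KK
  have : (2 : ℝ) ^ (-(s - 1)) < 1 := Real.rpow_lt_one_of_one_lt_of_neg (by norm_num) (by linarith)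
  exact inv_pos.2 (by linarith)

theorem step_le {s x : ℝ} (hs : 1 < s) (hx : 1 ≤ x) :
    x ^ (-s) + KK s * (x + 1) ^ (1 - s) ≤ KK s * x ^ (1 - s) := by
  have hx0 : 0 < x := by linarith
  set r := s - 1 with hr
  have hr0 : 0 < r := by linarith
  set u := x⁻¹ with hu
  have hu0 : 0 < u := inv_pos.2 hx0
  have hu1 : u ≤ 1 := inv_le_one_of_one_le₀ hx
  have hq : (2 : ℝ) ^ (-r) < 1 := Real.rpow_lt_one_of_one_lt_of_neg (by norm_num) (by linarith)
  have hq0 : 0 < (2 : ℝ) ^ (-r) := by positivity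
  have b1 : (2 : ℝ) ^ u ≤ 1 + u := by
    have := rpow_one_add_le_one_add_mul_self (s := (1 : ℝ)) (by norm_num) hu0.le hu1
    norm_num at this
    simpa using this
  have b2 : ((2 : ℝ) ^ (-r)) ^ u ≤ 1 + u * ((2 : ℝ) ^ (-r) - 1) := by
    have := rpow_one_add_le_one_add_mul_self (s := (2 : ℝ) ^ (-r) - 1) (by linarith) hu0.le hu1
    simpa using this
  have b3 : (1 + u) ^ (-r) ≤ 1 - u * (1 - (2 : ℝ) ^ (-r)) := by
    calc (1 + u) ^ (-r) ≤ ((2 : ℝ) ^ u) ^ (-r) :=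
          Real.rpow_le_rpow_of_nonpos (by positivity) b1 (by linarith)
      _ = ((2 : ℝ) ^ (-r)) ^ u := by
          rw [← Real.rpow_mul (by norm_num), ← Real.rpow_mul (by norm_num), mul_comm]
      _ ≤ _ := by linarith
  have e1 : x ^ (-s) = x ^ (-r) * u := by
    rw [hu, ← Real.rpow_neg_one, ← Real.rpow_add hx0]; congr 1; linarith
  have e2 : (x + 1) ^ (1 - s) = x ^ (-r) * (1 + u) ^ (-r) := by
    rw [← Real.mul_rpow hx0.le (by positivity)]
    congr 1
    · rw [hu]; field_simp
    · linarith
  have e3 : x ^ (1 - s) = x ^ (-r) := by congr 1; linarith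
  rw [e1, e2, e3]
  have hK : KK s * (1 - (2 : ℝ) ^ (-r)) = 1 := by
    unfold KK; rw [← hr]; exact inv_mul_cancel₀ (by linarith)
  have hKp := KK_pos hs
  have : u + KK s * (1 + u) ^ (-r) ≤ KK s := by
    have := mul_le_mul_of_nonneg_left b3 hKp.le
    have e : KK s * (1 - u * (1 - (2 : ℝ) ^ (-r))) = KK s - u := by
      linear_combination (-u) * hK
    linarith
  have h2 := mul_le_mul_of_nonneg_left this (by positivity : 0 ≤ x ^ (-r))
  linarith

theorem sum_range_le {s : ℝ} (hs : 1 < s) (n : ℕ) : ∀ {x : ℝ}, 1 ≤ x →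
    ∑ k ∈ Finset.range n, (x + (k : ℝ)) ^ (-s) ≤ KK s * x ^ (1 - s) := by
  induction n with
  | zero =>
    intro x hx
    have := KK_pos hs
    simp only [Finset.range_zero, Finset.sum_empty]
    positivity
  | succ n ih =>
    intro x hx
    rw [Finset.sum_range_succ']
    have := ih (x := x + 1) (by linarith)
    have h2 := step_le hs hx
    have e : ∑ k ∈ Finset.range n, (x + ((k + 1 : ℕ) : ℝ)) ^ (-s)
        = ∑ k ∈ Finset.range n, (x + 1 + (k : ℝ)) ^ (-s) := by
      apply Finset.sum_congr rfl
      intro k _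
      congr 1
      push_cast; ring
    rw [e]
    simp only [Nat.cast_zero, add_zero]
    linarith

theorem sum_dist_le {N : ℕ} {s x : ℝ} (hs : 1 < s) (hx : 1 ≤ x) (j : Fin N) :
    ∑ i : Fin N, (x + (cdist i j : ℝ)) ^ (-s) ≤ 2 * KK s * x ^ (1 - s) := by
  rw [mul_assoc]
  exact sum_cdist_le (fun k => (x + (k : ℝ)) ^ (-s)) (fun k => by positivity) _
    (fun n => sum_range_le hs n hx) j

/-- pointwise majorant -/
noncomputable def TT {N : ℕ} (s : ℝ) (p a b q : Fin N) : ℝ :=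
  (((cdist p q : ℝ) + 1 + (cdist a q : ℝ)) + (cdist b p : ℝ)) ^ (-s)
    + ((cdist p q : ℝ) + 1 + (cdist b a : ℝ)) ^ (-s)

noncomputable def CT (s : ℝ) : ℝ := 2 * KK s * (2 * KK (s - 1)) + 2 * KK s

theorem CT_pos {s : ℝ} (hs : 2 < s) : 0 < CT s := by
  have := KK_pos (s := s) (by linarith)
  have := KK_pos (s := s - 1) (by linarith)
  unfold CT; positivity

theorem sum_TT_le {N : ℕ} {s : ℝ} (hs : 2 < s) (p q : Fin N) :
    ∑ a, ∑ b, TT s p a b q ≤ CT s * N * (1 + (cdist p q : ℝ)) ^ (1 - s) := by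
  unfold TT
  simp only [Finset.sum_add_distrib]
  set D : ℝ := (cdist p q : ℝ) with hD
  have hD0 : 0 ≤ D := by positivity
  have hDN : 1 + D ≤ N := by
    have := cdist_lt p q
    rw [hD]
    exact_mod_cast (by omega : 1 + cdist p q ≤ N)
  have k1 := KK_pos (s := s) (by linarith)
  have k2 := KK_pos (s := s - 1) (by linarith)
  have h1 : ∑ a : Fin N, ∑ b : Fin N, (D + 1 + (cdist a q : ℝ) + (cdist b p : ℝ)) ^ (-s)
      ≤ 2 * KK s * (2 * KK (s - 1)) * N * (1 + D) ^ (1 - s) := by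
    calc _ ≤ ∑ a : Fin N, 2 * KK s * (D + 1 + (cdist a q : ℝ)) ^ (-(s - 1)) := by
          apply Finset.sum_le_sum
          intro a _
          have := sum_dist_le (s := s) (x := D + 1 + (cdist a q : ℝ)) (by linarith)
            (by have : (0 : ℝ) ≤ cdist a q := by positivity
                linarith) p
          rwa [show -(s - 1) = 1 - s by ring]
      _ = 2 * KK s * ∑ a : Fin N, (D + 1 + (cdist a q : ℝ)) ^ (-(s - 1)) := by
          rw [Finset.mul_sum]
      _ ≤ 2 * KK s * (2 * KK (s - 1) * (D + 1) ^ (1 - (s - 1))) := by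
          gcongr
          exact sum_dist_le (by linarith) (by linarith) q
      _ = 2 * KK s * (2 * KK (s - 1)) * (1 + D) * (1 + D) ^ (1 - s) := by
          rw [show 1 - (s - 1) = 1 + (1 - s) by ring, Real.rpow_add (by linarith),
            Real.rpow_one, add_comm D 1]
          ring
      _ ≤ _ := by gcongr
  have h2 : ∑ a : Fin N, ∑ b : Fin N, (D + 1 + (cdist b a : ℝ)) ^ (-s)
      ≤ 2 * KK s * N * (1 + D) ^ (1 - s) := by
    calc _ ≤ ∑ a : Fin N, 2 * KK s * (D + 1) ^ (1 - s) := by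
          apply Finset.sum_le_sum
          intro a _
          exact sum_dist_le (by linarith) (by linarith) a
      _ = _ := by
          rw [Finset.sum_const, Finset.card_univ, Fintype.card_fin, nsmul_eq_mul, add_comm D 1]
          ring
  unfold CT
  linarith

theorem xi_le {c x d D l k e : ℝ} (hd : 0 < d) (hc : 0 ≤ c) (hD : 0 ≤ D) (hl : 0 ≤ l)
    (hk : 0 ≤ k) (he : 0 ≤ e)
    (h1 : x ≤ c * max ((k + l + 1) ^ (-d)) ((D + e + 1) ^ (-d)))
    (h2 : x ≤ c * (1 + D) ^ (-d)) :
    x ≤ c * 2 ^ d * max ((D + 1 + l + k) ^ (-d)) ((D + 1 + e) ^ (-d)) := by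
  have key : ∀ y : ℝ, 1 ≤ y → D + 1 + l + k ≤ 2 * y → x ≤ c * y ^ (-d) →
      x ≤ c * 2 ^ d * max ((D + 1 + l + k) ^ (-d)) ((D + 1 + e) ^ (-d)) := by
    intro y hy hyy hxy
    refine hxy.trans ?_
    rw [mul_assoc]
    apply mul_le_mul_of_nonneg_left _ hc
    calc y ^ (-d) = 2 ^ d * (2 * y) ^ (-d) := by
          rw [Real.mul_rpow (by norm_num) (by linarith), ← mul_assoc, ← Real.rpow_add (by norm_num)]
          simp
      _ ≤ 2 ^ d * (D + 1 + l + k) ^ (-d) := by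
          apply mul_le_mul_of_nonneg_left _ (by positivity)
          exact Real.rpow_le_rpow_of_nonpos (by positivity) hyy (by linarith)
      _ ≤ _ := by
          apply mul_le_mul_of_nonneg_left (le_max_left _ _) (by positivity)
  rcases max_choice ((k + l + 1) ^ (-d)) ((D + e + 1) ^ (-d)) with h | h
  · rw [h] at h1
    rcases le_total (k + l) D with hh | hh
    · exact key (1 + D) (by linarith) (by linarith) h2
    · exact key (k + l + 1) (by linarith) (by linarith) h1
  · rw [h] at h1
    refine h1.trans ?_
    rw [mul_assoc]
    apply mul_le_mul_of_nonneg_left _ hc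
    have h3 : (D + e + 1) ^ (-d) ≤ max ((D + 1 + l + k) ^ (-d)) ((D + 1 + e) ^ (-d)) := by
      rw [show D + e + 1 = D + 1 + e by ring]; exact le_max_right _ _
    have h4 : (1 : ℝ) ≤ 2 ^ d := Real.one_le_rpow (by norm_num) hd.le
    have h5 : 0 ≤ max ((D + 1 + l + k) ^ (-d)) ((D + 1 + e) ^ (-d)) :=
      le_max_of_le_left (by positivity)
    nlinarith

theorem Smap_norm_le {N : ℕ} (ξ : Fin N → Fin N → Fin N → Fin N → ℝ)
    (A : Matrix (Fin N) (Fin N) ℂ) (p q : Fin N) :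
    ‖SmapXi ξ A p q‖ ≤ (N : ℝ)⁻¹ * ∑ a, ∑ b, |ξ p a b q| * ‖A a b‖ := by
  unfold SmapXi
  simp only [Matrix.of_apply, norm_mul, norm_inv, Complex.norm_natCast]
  gcongr
  refine (norm_sum_le _ _).trans (Finset.sum_le_sum fun a _ => ?_)
  refine (norm_sum_le _ _).trans (Finset.sum_le_sum fun b _ => ?_)
  rw [norm_mul, Complex.norm_real, Real.norm_eq_abs]

theorem hs_le {N : ℕ} (A : Matrix (Fin N) (Fin N) ℂ) :
    ∑ a, ∑ b, ‖A a b‖ ^ 2 ≤ N * l2OpNorm A ^ 2 := by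
  rw [Finset.sum_comm]
  have : ∀ b, ∑ a, ‖A a b‖ ^ 2 ≤ l2OpNorm A ^ 2 := by
    intro b
    have h := ContinuousLinearMap.le_opNorm
      (LinearMap.toContinuousLinearMap (Matrix.toEuclideanLin A)) (EuclideanSpace.single b (1 : ℂ))
    rw [EuclideanSpace.norm_single, norm_one, mul_one] at h
    change _ ≤ l2OpNorm A at h
    have h2 := pow_le_pow_left₀ (norm_nonneg _) h 2
    rw [EuclideanSpace.norm_sq_eq] at h2
    simpa [Matrix.toEuclideanLin, Matrix.mulVec_single] using h2
  calc _ ≤ ∑ _b : Fin N, l2OpNorm A ^ 2 := Finset.sum_le_sum fun b _ => this b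
    _ = _ := by simp

theorem piLp_norm_mono (p : ENNReal) [Fact (1 ≤ p)] {N : ℕ} (x y : PiLp p (fun _ : Fin N => ℂ))
    (h : ∀ i, ‖x i‖ ≤ ‖y i‖) : ‖x‖ ≤ ‖y‖ := by
  rcases eq_or_ne p ⊤ with rfl | hp
  · rw [PiLp.norm_eq_ciSup, PiLp.norm_eq_ciSup]
    exact ciSup_mono (Set.finite_range _).bddAbove h
  · have hp0 : 0 < p.toReal :=
      ENNReal.toReal_pos (zero_lt_one.trans_le (Fact.out : 1 ≤ p)).ne' hp
    rw [PiLp.norm_eq_sum hp0, PiLp.norm_eq_sum hp0]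
    gcongr with i
    exact h i

theorem lpOpNorm_le (p : ENNReal) [Fact (1 ≤ p)] {N : ℕ} (M : Matrix (Fin N) (Fin N) ℂ)
    (g : ℕ → ℝ) (hg : ∀ k, 0 ≤ g k) (C : ℝ) (hC : ∀ n, ∑ k ∈ Finset.range n, g k ≤ C)
    (hM : ∀ i j, ‖M i j‖ ≤ g (cdist i j)) : lpOpNorm p M ≤ 2 * C := by
  have hC0 : 0 ≤ C := by simpa using hC 0
  apply ContinuousLinearMap.opNorm_le_bound _ (by linarith)
  intro x
  rcases Nat.eq_zero_or_pos N with rfl | hN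
  · have hx : x = 0 := by ext i; exact i.elim0
    rw [hx]; simp
  haveI : NeZero N := ⟨by omega⟩
  let y : Fin N → PiLp p (fun _ : Fin N => ℂ) := fun t =>
    WithLp.toLp p (fun i => M i (i + t) * x (i + t))
  have hy : ∀ t, ‖y t‖ ≤ g (min (t : ℕ) (N - t)) * ‖x‖ := by
    intro t
    have e : ‖LinearIsometryEquiv.piLpCongrLeft p ℂ ℂ (Equiv.addRight t).symm x‖ = ‖x‖ :=
      LinearIsometryEquiv.norm_map _ _
    rw [← e]
    set z := LinearIsometryEquiv.piLpCongrLeft p ℂ ℂ (Equiv.addRight t).symm x with hz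
    have hzi : ∀ i, z i = x (i + t) := by
      intro i
      simp [hz, LinearIsometryEquiv.piLpCongrLeft_apply]
    have h1 : ‖y t‖ ≤ ‖((g (min (t : ℕ) (N - t)) : ℝ) : ℂ) • z‖ := by
      apply piLp_norm_mono
      intro i
      rw [PiLp.smul_apply, norm_smul, hzi, Complex.norm_real, Real.norm_of_nonneg (hg _)]
      simp only [y, norm_mul]
      gcongr
      rw [← cdist_add i t, cdist_comm']
      exact hM _ _
    rwa [norm_smul, Complex.norm_real, Real.norm_of_nonneg (hg _)] at h1
  have hs : (LinearMap.toContinuousLinearMap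
      (((WithLp.linearEquiv p ℂ (Fin N → ℂ)).symm.toLinearMap.comp M.mulVecLin).comp
      (WithLp.linearEquiv p ℂ (Fin N → ℂ)).toLinearMap)) x = ∑ t, y t := by
    ext i
    rw [WithLp.ofLp_sum, Finset.sum_apply]
    simp only [y]
    change ∑ j, M i j * x j = _
    rw [← Equiv.sum_comp (Equiv.addLeft i)]
    rfl
  rw [hs]
  calc _ ≤ ∑ t, ‖y t‖ := norm_sum_le _ _
    _ ≤ ∑ t : Fin N, g (min (t : ℕ) (N - t)) * ‖x‖ := Finset.sum_le_sum fun t _ => hy t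
    _ = (∑ t : Fin N, g (min (t : ℕ) (N - t))) * ‖x‖ := by rw [Finset.sum_mul]
    _ ≤ _ := by
      gcongr
      exact sum_min_le N g hg C hC

theorem mul_rpow_le {x y M t : ℝ} (hy : 0 < y) (h : x ≤ M * y ^ (-t)) : x * y ^ t ≤ M := by
  calc x * y ^ t ≤ M * y ^ (-t) * y ^ t := by gcongr
    _ = M := by rw [mul_assoc, ← Real.rpow_add hy]; simp

/-- Boundedness and smoothing properties of the self-energy operator `S`. -/
theorem Smap_bounds (d c₁ : ℝ) (hd : 2 < d) (hc₁ : 0 < c₁) :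
    ∃ c : ℝ, 0 < c ∧
      ∀ (N : ℕ) (ξ : Fin N → Fin N → Fin N → Fin N → ℝ),
        (∀ p a b q : Fin N, |ξ p a b q| ≤
          c₁ ^ 2 * max (((cdist p b : ℝ) + (cdist a q : ℝ) + 1) ^ (-d))
            (((cdist p q : ℝ) + (cdist a b : ℝ) + 1) ^ (-d))) →
        (∀ p a b q : Fin N, |ξ p a b q| ≤ c₁ ^ 2 * (1 + (cdist p q : ℝ)) ^ (-d)) →
        ∀ A : Matrix (Fin N) (Fin N) ℂ,
          normDecayCirc (d - 1) (SmapXi ξ A) ≤ c * entryMax A ∧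
          (∀ (p : ENNReal) (hp : 1 ≤ p),
            @lpOpNorm p ⟨hp⟩ N (SmapXi ξ A) ≤ c * entryMax A) ∧
          normDecayCirc d (SmapXi ξ A) ≤ c * normDecayCirc (d - 1) A ∧
          normDecayCirc (d - 1 / 2) (SmapXi ξ A) ≤ c * l2OpNorm A := by
  set E : ℝ := c₁ ^ 2 * 2 ^ d with hE
  have hE0 : 0 < E := by positivity
  have hCT := CT_pos hd
  have hCT2 := CT_pos (s := 2 * d) (by linarith)
  have hK1 := KK_pos (s := d - 1) (by linarith)
  have hR0 : 0 ≤ Real.sqrt (E ^ 2 * CT (2 * d)) := Real.sqrt_nonneg _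
  set R := Real.sqrt (E ^ 2 * CT (2 * d)) with hR
  set a1 := E * CT d with ha1
  set a2 := 2 * (a1 * KK (d - 1)) with ha2
  set a3 := c₁ ^ 2 * (2 * KK (d - 1)) with ha3
  have h1p : 0 < a1 := by positivity
  have h2p : 0 < a2 := by positivity
  have h3p : 0 < a3 := by positivity
  refine ⟨a1 + a2 + a3 + R, by positivity, ?_⟩
  intro N ξ hx1 hx2 A
  have hW0 : 0 ≤ entryMax A := fold_nonneg _
  have hB0 : 0 ≤ normDecayCirc (d - 1) A := fold_nonneg _
  have hL0 : 0 ≤ l2OpNorm A := norm_nonneg _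
  have hAW : ∀ i j, ‖A i j‖ ≤ entryMax A := fun i j =>
    le_fold (fun p : Fin N × Fin N => ‖A p.1 p.2‖) i j
  have hAB : ∀ i j, ‖A i j‖ ≤ normDecayCirc (d - 1) A * (1 + (cdist i j : ℝ)) ^ (-(d - 1)) := by
    intro i j
    have h := le_fold (fun p : Fin N × Fin N =>
      ‖A p.1 p.2‖ * (1 + (cdist p.1 p.2 : ℝ)) ^ (d - 1)) i j
    change _ ≤ normDecayCirc (d - 1) A at h
    have hy : (0 : ℝ) < 1 + (cdist i j : ℝ) := by positivity
    rw [Real.rpow_neg hy.le, ← div_eq_mul_inv, le_div_iff₀ (by positivity)]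
    exact h
  have hξ : ∀ p a b q : Fin N, |ξ p a b q| ≤ E *
      max (((cdist p q : ℝ) + 1 + (cdist a q : ℝ) + (cdist b p : ℝ)) ^ (-d))
        (((cdist p q : ℝ) + 1 + (cdist b a : ℝ)) ^ (-d)) := by
    intro p a b q
    have h1 := hx1 p a b q
    rw [cdist_comm' p b, cdist_comm' a b] at h1
    exact xi_le (by linarith) (by positivity) (by positivity) (by positivity)
      (by positivity) (by positivity) h1 (hx2 p a b q)
  have hξ1 : ∀ p a b q : Fin N, |ξ p a b q| ≤ E * TT d p a b q := by
    intro p a b q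
    refine (hξ p a b q).trans ?_
    unfold TT
    gcongr
    exact max_le_add_of_nonneg (by positivity) (by positivity)
  have hξ2 : ∀ p a b q : Fin N, |ξ p a b q| ^ 2 ≤ E ^ 2 * TT (2 * d) p a b q := by
    intro p a b q
    refine (pow_le_pow_left₀ (abs_nonneg _) (hξ p a b q) 2).trans ?_
    rw [mul_pow]
    unfold TT
    gcongr
    have e : ∀ y : ℝ, 0 ≤ y → y ^ (-(2 * d)) = (y ^ (-d)) ^ 2 := by
      intro y hy
      rw [← Real.rpow_natCast, ← Real.rpow_mul hy]
      congr 1; push_cast; ring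
    rw [e _ (by positivity), e _ (by positivity)]
    rcases max_choice (((cdist p q : ℝ) + 1 + (cdist a q : ℝ) + (cdist b p : ℝ)) ^ (-d))
        (((cdist p q : ℝ) + 1 + (cdist b a : ℝ)) ^ (-d)) with h | h <;> rw [h]
    · exact le_add_of_nonneg_right (by positivity)
    · exact le_add_of_nonneg_left (by positivity)
  have hN : ∀ p : Fin N, (0 : ℝ) < N := fun p => by
    have := p.2
    exact_mod_cast (by omega : 0 < N)
  -- entrywise bound for (1)
  have hS1 : ∀ p q, ‖SmapXi ξ A p q‖ ≤
      a1 * entryMax A * (1 + (cdist p q : ℝ)) ^ (-(d - 1)) := by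
    intro p q
    have hNp := hN p
    refine (Smap_norm_le ξ A p q).trans ?_
    calc _ ≤ (N : ℝ)⁻¹ * ∑ a, ∑ b, E * entryMax A * TT d p a b q := by
          apply mul_le_mul_of_nonneg_left _ (by positivity)
          refine Finset.sum_le_sum fun a _ => Finset.sum_le_sum fun b _ => ?_
          calc _ ≤ (E * TT d p a b q) * entryMax A := by
                apply mul_le_mul (hξ1 p a b q) (hAW a b) (norm_nonneg _)
                exact (abs_nonneg _).trans (hξ1 p a b q)
            _ = _ := by ring
      _ = (N : ℝ)⁻¹ * (E * entryMax A * ∑ a, ∑ b, TT d p a b q) := by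
          simp only [Finset.mul_sum]
      _ ≤ (N : ℝ)⁻¹ * (E * entryMax A * (CT d * N * (1 + (cdist p q : ℝ)) ^ (1 - d))) := by
          gcongr
          exact sum_TT_le hd p q
      _ = _ := by
          rw [show -(d - 1) = 1 - d by ring, ha1]
          field_simp
  have hS3 : ∀ p q, ‖SmapXi ξ A p q‖ ≤
      a3 * normDecayCirc (d - 1) A * (1 + (cdist p q : ℝ)) ^ (-d) := by
    intro p q
    have hNp := hN p
    refine (Smap_norm_le ξ A p q).trans ?_
    set B := normDecayCirc (d - 1) A with hB
    set Y := (1 + (cdist p q : ℝ)) ^ (-d) with hY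
    have hY0 : 0 ≤ Y := by positivity
    calc _ ≤ (N : ℝ)⁻¹ * ∑ a : Fin N, ∑ b : Fin N,
            c₁ ^ 2 * Y * B * (1 + (cdist b a : ℝ)) ^ (-(d - 1)) := by
          apply mul_le_mul_of_nonneg_left _ (by positivity)
          refine Finset.sum_le_sum fun a _ => Finset.sum_le_sum fun b _ => ?_
          rw [mul_assoc (c₁ ^ 2 * Y), cdist_comm' b a]
          exact mul_le_mul (hx2 p a b q) (hAB a b) (norm_nonneg _) (by positivity)
      _ = (N : ℝ)⁻¹ * (c₁ ^ 2 * Y * B *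
            ∑ a : Fin N, ∑ b : Fin N, (1 + (cdist b a : ℝ)) ^ (-(d - 1))) := by
          simp only [Finset.mul_sum]
      _ ≤ (N : ℝ)⁻¹ * (c₁ ^ 2 * Y * B * ∑ _a : Fin N, 2 * KK (d - 1)) := by
          gcongr with a _
          have := sum_dist_le (s := d - 1) (x := 1) (by linarith) le_rfl a
          simpa using this
      _ = _ := by
          rw [Finset.sum_const, Finset.card_univ, Fintype.card_fin, nsmul_eq_mul, ha3]
          field_simp
  have hS4 : ∀ p q, ‖SmapXi ξ A p q‖ ≤
      R * l2OpNorm A * (1 + (cdist p q : ℝ)) ^ (-(d - 1 / 2)) := by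
    intro p q
    have hNp := hN p
    refine (Smap_norm_le ξ A p q).trans ?_
    have hy : (0 : ℝ) < 1 + (cdist p q : ℝ) := by positivity
    refine (pow_le_pow_iff_left₀ (by positivity) (by positivity) two_ne_zero).1 ?_
    have cs : (∑ a, ∑ b, |ξ p a b q| * ‖A a b‖) ^ 2 ≤
        (∑ a, ∑ b, |ξ p a b q| ^ 2) * (∑ a, ∑ b, ‖A a b‖ ^ 2) := by
      simp only [← Fintype.sum_prod_type']
      exact Finset.sum_mul_sq_le_sq_mul_sq Finset.univ
        (fun x : Fin N × Fin N => |ξ p x.1 x.2 q|) (fun x => ‖A x.1 x.2‖)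
    have t1 : ∑ a, ∑ b, |ξ p a b q| ^ 2 ≤
        E ^ 2 * (CT (2 * d) * N * (1 + (cdist p q : ℝ)) ^ (1 - 2 * d)) := by
      calc _ ≤ ∑ a, ∑ b, E ^ 2 * TT (2 * d) p a b q := by
            gcongr with a _ b _
            exact hξ2 p a b q
        _ = E ^ 2 * ∑ a, ∑ b, TT (2 * d) p a b q := by simp only [Finset.mul_sum]
        _ ≤ _ := by
            gcongr
            exact sum_TT_le (by linarith) p q
    have e : ((1 + (cdist p q : ℝ)) ^ (-(d - 1 / 2))) ^ 2
        = (1 + (cdist p q : ℝ)) ^ (1 - 2 * d) := by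
      rw [← Real.rpow_natCast, ← Real.rpow_mul hy.le]
      congr 1; push_cast; ring
    have hR2 : R ^ 2 = E ^ 2 * CT (2 * d) := Real.sq_sqrt (by positivity)
    rw [mul_pow, mul_pow, mul_pow, e, hR2]
    calc _ ≤ ((N : ℝ)⁻¹) ^ 2 * ((E ^ 2 * (CT (2 * d) * N *
            (1 + (cdist p q : ℝ)) ^ (1 - 2 * d))) * (N * l2OpNorm A ^ 2)) := by
          apply mul_le_mul_of_nonneg_left _ (by positivity)
          refine cs.trans (mul_le_mul t1 (hs_le A) (by positivity) (by positivity))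
      _ = _ := by field_simp
  refine ⟨?_, ?_, ?_, ?_⟩
  · refine (fold_le _ (a1 * entryMax A) (by positivity) ?_).trans ?_
    · intro i j
      exact mul_rpow_le (by positivity) (hS1 i j)
    · gcongr; linarith
  · intro p hp
    haveI : Fact (1 ≤ p) := ⟨hp⟩
    have := lpOpNorm_le p (SmapXi ξ A)
      (fun k => a1 * entryMax A * (1 + (k : ℝ)) ^ (-(d - 1))) (fun k => by positivity)
      (a1 * entryMax A * KK (d - 1)) (by
        intro n
        rw [← Finset.mul_sum]
        gcongr
        have := sum_range_le (s := d - 1) (by linarith) n (le_refl (1 : ℝ))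
        simpa using this) hS1
    refine this.trans ?_
    calc _ = a2 * entryMax A := by rw [ha2]; ring
      _ ≤ _ := by gcongr; linarith
  · refine (fold_le _ (a3 * normDecayCirc (d - 1) A) (by positivity) ?_).trans ?_
    · intro i j
      exact mul_rpow_le (by positivity) (hS3 i j)
    · gcongr; linarith
  · refine (fold_le _ (R * l2OpNorm A) (by positivity) ?_).trans ?_
    · intro i j
      exact mul_rpow_le (by positivity) (hS4 i j)
    · gcongr; linarith
end

section
/- Let α>2. There is a constant C=C(α) such that for every N∈ℕ and all a,b∈C(𝕋²) with ‖a‖_α<∞, ‖b‖_α<∞ and b Lipschitz in the first variable with constant L (i.e. |b(s,u)−b(s',u)| ≤ L·dist_𝕋(s,s') for all s,s',u), one has ‖D(a)D(b) − D(ab)‖ ≤ C N^{−1/2}(L+‖b‖_α)‖a‖_α and ‖D(a)D(b)* − D(a·b̄)‖ ≤ C N^{−1/2}(L+‖b‖_α)‖a‖_α, where ‖·‖ is the ℓ²→ℓ² operator norm and * is the conjugate transpose. -/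
open MeasureTheory Matrix

/-- Fourier coefficient in the second variable: `ĥ(s,k) = ∫₀¹ h(s,u) e^{−2πiku} du`. -/
noncomputable def fhat (h : UnitAddCircle → UnitAddCircle → ℂ)
    (s : UnitAddCircle) (k : ℤ) : ℂ :=
  ∫ u : UnitAddCircle, h s u * fourier (-k) u

/-- Representative of `m` in `(−N/2, N/2]`. -/
def tauRep (N : ℕ) (m : ℤ) : ℤ :=
  if 2 * (m % (N : ℤ)) ≤ (N : ℤ) then m % (N : ℤ) else m % (N : ℤ) - N

/-- The discretization `D(h)_{ij} := ĥ(i/N, τ(j−i))`. -/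
noncomputable def Dmat (N : ℕ) (h : UnitAddCircle → UnitAddCircle → ℂ) :
    Matrix (Fin N) (Fin N) ℂ :=
  Matrix.of fun i j =>
    fhat h ((((i : ℕ) : ℝ) / (N : ℝ) : ℝ) : UnitAddCircle) (tauRep N ((j : ℤ) - (i : ℤ)))

/-- weights used throughout -/
structure GoodW (w : ℤ → ℝ) : Prop where
  pos : ∀ m, 0 < w m
  le : ∀ m, w m * (1 + |(m : ℝ)|) ≤ 1
  anti : ∀ m n : ℤ, |m| ≤ |n| → w n ≤ w m
  summ : Summable w

lemma GoodW.le_one {w : ℤ → ℝ} (hw : GoodW w) (m : ℤ) : w m ≤ 1 := by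
  have := hw.le m
  nlinarith [hw.pos m, abs_nonneg (m : ℝ)]

/-- Bilinear form bound. -/
def Bd {ι : Type*} [Fintype ι] (A : ι → ι → ℂ) (R : ℝ) : Prop :=
  ∀ y f : ι → ℂ, ‖∑ i, ∑ j, y i * A i j * f j‖ ≤ R / 2 * (∑ i, ‖y i‖ ^ 2 + ∑ i, ‖f i‖ ^ 2)

lemma Bd.add {ι : Type*} [Fintype ι] {A B : ι → ι → ℂ} {R S : ℝ} (hA : Bd A R) (hB : Bd B S) :
    Bd (fun i j => A i j + B i j) (R + S) := by
  intro y f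
  have : ∑ i, ∑ j, y i * (A i j + B i j) * f j
      = ∑ i, ∑ j, y i * A i j * f j + ∑ i, ∑ j, y i * B i j * f j := by
    simp only [← Finset.sum_add_distrib]
    refine Finset.sum_congr rfl fun i _ => Finset.sum_congr rfl fun j _ => by ring
  rw [this]
  refine (norm_add_le _ _).trans ?_
  have := hA y f
  have := hB y f
  nlinarith

lemma Bd.neg {ι : Type*} [Fintype ι] {A : ι → ι → ℂ} {R : ℝ} (hA : Bd A R) :
    Bd (fun i j => - A i j) R := by
  intro y f
  simpa using hA y f

lemma Bd.transpose {ι : Type*} [Fintype ι] {A : ι → ι → ℂ} {R : ℝ} (hA : Bd A R) :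
    Bd (fun i j => A j i) R := by
  intro y f
  have := hA f y
  rw [Finset.sum_comm, add_comm]
  have e : ∀ i j, f i * A i j * y j = y j * A i j * f i := fun i j => by ring
  simpa only [e] using this

lemma Bd.schur {N : ℕ} [NeZero N] {A : ZMod N → ZMod N → ℂ} {g : ZMod N → ℝ} {R : ℝ}
    (hg : ∀ i j, ‖A i j‖ ≤ g (j - i)) (hR : ∑ d, g d ≤ R) : Bd A R := by
  intro y f
  have hrow : ∀ i, ∑ j, g (j - i) = ∑ d, g d := fun i =>
    Equiv.sum_comp (Equiv.subRight i) g
  have hcol : ∀ j, ∑ i, g (j - i) = ∑ d, g d := fun j =>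
    Equiv.sum_comp (Equiv.subLeft j) g
  calc ‖∑ i, ∑ j, y i * A i j * f j‖
      ≤ ∑ i, ∑ j, (g (j - i) * ‖y i‖ ^ 2 / 2 + g (j - i) * ‖f j‖ ^ 2 / 2) := by
        refine norm_sum_le_of_le _ fun i _ => norm_sum_le_of_le _ fun j _ => ?_
        rw [norm_mul, norm_mul]
        have h0 : 0 ≤ g (j - i) := (norm_nonneg _).trans (hg i j)
        have h1 : ‖y i‖ * ‖A i j‖ * ‖f j‖ ≤ ‖y i‖ * g (j - i) * ‖f j‖ := by
          gcongr; exact hg i j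
        nlinarith [mul_nonneg h0 (sq_nonneg (‖y i‖ - ‖f j‖))]
    _ = (∑ d, g d) / 2 * (∑ i, ‖y i‖ ^ 2 + ∑ i, ‖f i‖ ^ 2) := by
        simp only [Finset.sum_add_distrib]
        rw [Finset.sum_comm (f := fun i j => g (j - i) * ‖f j‖ ^ 2 / 2)]
        simp only [← Finset.sum_div, ← Finset.sum_mul, hrow, hcol, ← Finset.mul_sum]
        ring
    _ ≤ _ := by gcongr

lemma opNorm_le_of_Bd {N : ℕ} {A : Matrix (Fin N) (Fin N) ℂ} {R : ℝ} (hR : 0 ≤ R)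
    (h : Bd (fun i j => A i j) R) : l2OpNorm A ≤ R := by
  unfold l2OpNorm
  refine ContinuousLinearMap.opNorm_le_bound _ hR fun v => ?_
  set u := (LinearMap.toContinuousLinearMap (Matrix.toEuclideanLin A)) v with hu
  have hui : ∀ i, u i = ∑ j, A i j * v j := by
    intro i
    simp [hu, Matrix.toEuclideanLin, Matrix.toLin'_apply, Matrix.mulVec, dotProduct]
  have hn : ∀ x : EuclideanSpace ℂ (Fin N), ∑ i, ‖x i‖ ^ 2 = ‖x‖ ^ 2 := fun x =>
    (EuclideanSpace.norm_sq_eq x).symm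
  rcases eq_or_lt_of_le (norm_nonneg u) with hu0 | hu0
  · rw [← hu0]; positivity
  rcases eq_or_lt_of_le (norm_nonneg v) with hv0 | hv0
  · have : v = 0 := norm_eq_zero.mp hv0.symm
    have : u = 0 := by rw [hu, this, map_zero]
    simp [this] at hu0
  have key := h (fun i => (‖v‖ : ℂ) * (starRingEnd ℂ) (u i)) (fun j => (‖u‖ : ℂ) * v j)
  have e1 : ∑ i, ∑ j, (‖v‖ : ℂ) * (starRingEnd ℂ) (u i) * A i j * ((‖u‖ : ℂ) * v j)
      = ((‖v‖ * ‖u‖ * ‖u‖ ^ 2 : ℝ) : ℂ) := by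
    rw [← hn u]
    push_cast
    rw [Finset.mul_sum]
    refine Finset.sum_congr rfl fun i _ => ?_
    rw [← Complex.conj_mul']
    conv_rhs => rw [hui i]
    simp only [Finset.mul_sum]
    refine Finset.sum_congr rfl fun j _ => ?_
    rw [hui i]; ring
  rw [e1, Complex.norm_of_nonneg (by positivity)] at key
  simp only [norm_mul, Complex.norm_real, norm_norm, RCLike.norm_conj, mul_pow, ← Finset.mul_sum,
    hn] at key
  have h3 : 0 < ‖v‖ * ‖u‖ ^ 2 := by positivity
  by_contra hc
  push Not at hc
  nlinarith [mul_lt_mul_of_pos_left hc h3]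

lemma opNorm_le_of_Bd' {N : ℕ} [NeZero N] {A : Matrix (Fin N) (Fin N) ℂ} {R : ℝ} (hR : 0 ≤ R)
    (B : ZMod N → ZMod N → ℂ) (hAB : ∀ i j : Fin N, A i j = B ((i : ℕ) : ZMod N) ((j : ℕ) : ZMod N))
    (h : Bd B R) : l2OpNorm A ≤ R := by
  refine opNorm_le_of_Bd hR ?_
  let e : Fin N ≃ ZMod N := 
    { toFun := fun i => ((i : ℕ) : ZMod N)
      invFun := fun z => ⟨z.val, ZMod.val_lt z⟩
      left_inv := fun i => by ext; simp [ZMod.val_natCast, Nat.mod_eq_of_lt i.2]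
      right_inv := fun z => by simp }
  intro y f
  have := h (y ∘ e.symm) (f ∘ e.symm)
  rw [← e.sum_comp, ← e.sum_comp (fun i => ‖(y ∘ e.symm) i‖ ^ 2),
    ← e.sum_comp (fun i => ‖(f ∘ e.symm) i‖ ^ 2)] at this
  simp only [← e.sum_comp (fun j => (y ∘ e.symm) _ * B _ j * (f ∘ e.symm) j)] at this
  simp only [Function.comp, e.symm_apply_apply] at this
  simpa only [hAB] using! this

lemma vma_bound {N : ℕ} [NeZero N] (x : ZMod N) : 2 * |(x.valMinAbs : ℝ)| ≤ N := by
  have h := ZMod.valMinAbs_mem_Ioc x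
  have h1 : -(N : ℤ) < x.valMinAbs * 2 := h.1
  have h2 : x.valMinAbs * 2 ≤ N := h.2
  have : 2 * |x.valMinAbs| ≤ N := by
    rcases abs_cases x.valMinAbs with h | h <;> omega
  exact_mod_cast this

lemma sum_inj_le {N : ℕ} [NeZero N] {w : ℤ → ℝ} (hw : GoodW w) (e : ZMod N → ℤ)
    (he : Function.Injective e) : ∑ d, w (e d) ≤ ∑' m, w m := by
  rw [← Finset.sum_image (f := w) (s := Finset.univ) (g := e) (fun a _ b _ h => he h)]
  exact hw.summ.sum_le_tsum _ fun i _ => (hw.pos i).le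

/-- conv -/
lemma conv_summable {w : ℤ → ℝ} (hw : GoodW w) (r : ℤ) : Summable fun m => w m * w (r - m) := by
  refine Summable.of_nonneg_of_le (fun m => mul_nonneg (hw.pos _).le (hw.pos _).le)
    (fun m => ?_) hw.summ
  have := hw.le_one (r - m)
  nlinarith [hw.pos m]

lemma sum_conv_le {N : ℕ} [NeZero N] {w : ℤ → ℝ} (hw : GoodW w) :
    ∑ d : ZMod N, ∑' m, w m * w (d.valMinAbs - m) ≤ (∑' m, w m) ^ 2 := by
  rw [← Summable.tsum_finsetSum (fun d _ => conv_summable hw _), sq, ← tsum_mul_right]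
  have hle : ∀ m, ∑ d : ZMod N, w m * w (d.valMinAbs - m) ≤ w m * ∑' m, w m := by
    intro m
    rw [← Finset.mul_sum]
    refine mul_le_mul_of_nonneg_left ?_ (hw.pos m).le
    exact sum_inj_le hw (fun d : ZMod N => d.valMinAbs - m) fun a b h => by
      simpa using h
  refine Summable.tsum_le_tsum hle ?_ (hw.summ.mul_right _)
  refine summable_sum fun d _ => conv_summable hw _

lemma sum_conv1_le {N : ℕ} [NeZero N] {w : ℤ → ℝ} (hw : GoodW w) :
    ∑ d : ZMod N, ∑ k : ZMod N, w k.valMinAbs * w (d - k).valMinAbs ≤ (∑' m, w m) ^ 2 := by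
  rw [Finset.sum_comm]
  have h1 : ∀ k : ZMod N, ∑ d : ZMod N, w (d - k).valMinAbs = ∑ d : ZMod N, w d.valMinAbs := fun k =>
    Equiv.sum_comp (Equiv.subRight k) (fun d : ZMod N => w d.valMinAbs)
  simp only [← Finset.mul_sum, h1]
  rw [← Finset.sum_mul, sq]
  have := sum_inj_le hw (fun d : ZMod N => d.valMinAbs) ZMod.injective_valMinAbs
  have h0 : 0 ≤ ∑ d : ZMod N, w d.valMinAbs := Finset.sum_nonneg fun _ _ => (hw.pos _).le
  exact mul_self_le_mul_self h0 this

lemma core1 {N : ℕ} [NeZero N] {w : ℤ → ℝ} (hw : GoodW w) (A : ℤ → ℂ) (B : ZMod N → ℤ → ℂ)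
    (δ L Ka Kb : ℝ) (hδ : 0 < δ) (hδN : δ ^ 2 * N = 1) (hL : 0 ≤ L) (hKa : 0 ≤ Ka) (hKb : 0 ≤ Kb)
    (hA : ∀ m, ‖A m‖ ≤ Ka * w m ^ 2) (hB : ∀ i m, ‖B i m‖ ≤ Kb * w m ^ 2)
    (hBL : ∀ i k m, ‖B k m - B i m‖ ≤ L * (|((k - i).valMinAbs : ℝ)| / N)) (i j : ZMod N) :
    ‖∑ k, A (k - i).valMinAbs * B k (j - k).valMinAbs -
        ∑' m, A m * B i ((j - i).valMinAbs - m)‖ ≤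
      4 * δ * Ka * (L + Kb) * (∑ k : ZMod N, w (k - i).valMinAbs * w (j - k).valMinAbs +
        ∑' m, w m * w ((j - i).valMinAbs - m)) := by
  set r := (j - i).valMinAbs with hr
  have hN1 : (1 : ℝ) ≤ N := by exact_mod_cast NeZero.one_le
  have hδ1 : δ ≤ 1 := by
    by_contra h; push Not at h
    nlinarith
  have hNδ : (N : ℝ) ≠ 0 := by positivity
  have hinv : 1 / (N : ℝ) = δ ^ 2 := by field_simp; linarith
  -- w m * w n small if |m|+|n| large
  have hsmall : ∀ m n : ℤ, (N : ℝ) ≤ 2 * (|(m : ℝ)| + |(n : ℝ)|) → w m * w n ≤ 2 * δ := by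
    intro m n h
    have h1 := hw.le m
    have h2 := hw.le n
    have hp := mul_pos (hw.pos m) (hw.pos n)
    have h3 : (w m * (1 + |(m : ℝ)|)) * (w n * (1 + |(n : ℝ)|)) ≤ 1 :=
      mul_le_one₀ h1 (mul_nonneg (hw.pos n).le (by positivity)) h2
    have h4 : (w m * w n) * (N / 2) ≤ 1 := by
      refine le_trans ?_ h3
      have : (w m * (1 + |(m : ℝ)|)) * (w n * (1 + |(n : ℝ)|))
        = (w m * w n) * ((1 + |(m : ℝ)|) * (1 + |(n : ℝ)|)) := by ring
      rw [this]
      refine mul_le_mul_of_nonneg_left ?_ hp.le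
      nlinarith [mul_nonneg (abs_nonneg (m : ℝ)) (abs_nonneg (n : ℝ))]
    have h5 : w m * w n ≤ 2 * δ ^ 2 := by
      have : w m * w n = (w m * w n) * (N / 2) * (2 * δ ^ 2) := by
        linear_combination (-(w m * w n)) * hδN
      rw [this]
      nlinarith [sq_nonneg δ]
    nlinarith
  set g : ℤ → ℂ := fun m => A m * B i (r - m) with hg
  have hgb : ∀ m, ‖g m‖ ≤ Ka * Kb * (w m ^ 2 * w (r - m) ^ 2) := by
    intro m
    rw [hg, norm_mul]
    calc _ ≤ (Ka * w m ^ 2) * (Kb * w (r - m) ^ 2) := by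
          gcongr
          · exact hA m
          · exact hB i _
      _ = _ := by ring
  have hww : ∀ m, 0 < w m * w (r - m) := fun m => mul_pos (hw.pos _) (hw.pos _)
  have hgsum : Summable g := by
    refine Summable.of_norm_bounded ((conv_summable hw r).mul_left (Ka * Kb)) fun m => ?_
    refine (hgb m).trans (mul_le_mul_of_nonneg_left ?_ (by positivity))
    have : w m * w (r - m) ≤ 1 := mul_le_one₀ (hw.le_one _) (hw.pos _).le (hw.le_one _)
    nlinarith [hww m]
  set ι : ZMod N → ℤ := fun k => (k - i).valMinAbs with hι
  have hιinj : Function.Injective ι := fun a b h => by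
    have := ZMod.injective_valMinAbs h
    simpa using this
  set s : Finset ℤ := Finset.univ.image ι with hs
  rw [← hgsum.sum_add_tsum_compl (s := s), hs, Finset.sum_image (fun a _ b _ h => hιinj h),
    ← sub_sub, ← Finset.sum_sub_distrib, mul_add]
  refine (norm_sub_le _ _).trans (add_le_add ?_ ?_)
  · rw [Finset.mul_sum]
    refine norm_sum_le_of_le _ fun k _ => ?_
    simp only [hg, hι]
    set p := (k - i).valMinAbs with hp
    set q := (j - k).valMinAbs with hq
    rw [← mul_sub, norm_mul]
    have hwp := hw.pos p
    have hwq := hw.pos q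
    have hdiff : w p * ‖B k q - B i (r - p)‖ ≤ 4 * δ * (L + Kb) * w q := by
      by_cases hc : q = r - p
      · rw [← hc]
        have h1 := hBL i k q
        have h2 : ‖B k q - B i q‖ ≤ 2 * Kb * w q ^ 2 := by
          refine (norm_sub_le _ _).trans ?_
          linarith [hB k q, hB i q]
        have h3 : w p * |(p : ℝ)| ≤ 1 := by nlinarith [hw.le p]
        have h4 : w p ≤ 1 := hw.le_one p
        set X := ‖B k q - B i q‖ with hX
        have hX0 : 0 ≤ X := norm_nonneg _
        have h5 : X ≤ L * |(p : ℝ)| * δ ^ 2 := by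
          rw [← hinv]; rw [← hp] at h1; convert h1 using 1; ring
        have h6 : (w p * X) ^ 2 ≤ ((L + Kb) * δ * w q) ^ 2 := by
          have a1 : X * X ≤ (L * |(p : ℝ)| * δ ^ 2) * (2 * Kb * w q ^ 2) :=
            mul_le_mul h5 h2 hX0 (by positivity)
          calc (w p * X) ^ 2 = w p ^ 2 * (X * X) := by ring
            _ ≤ w p ^ 2 * ((L * |(p : ℝ)| * δ ^ 2) * (2 * Kb * w q ^ 2)) := by gcongr
            _ = (w p * (w p * |(p : ℝ)|)) * ((2 * L * Kb) * (δ ^ 2 * w q ^ 2)) := by ring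
            _ ≤ 1 * ((L + Kb) ^ 2 * (δ ^ 2 * w q ^ 2)) := by
                refine mul_le_mul (mul_le_one₀ h4 (by positivity) h3) ?_ (by positivity) (by norm_num)
                refine mul_le_mul_of_nonneg_right ?_ (by positivity)
                nlinarith
            _ = _ := by ring
        have h7 := (pow_le_pow_iff_left₀ (by positivity) (by positivity) two_ne_zero).1 h6
        have h8 : 0 ≤ (L + Kb) * δ * w q := by positivity
        linarith
      · have hmod : (N : ℤ) ∣ q - (r - p) := by
          rw [← ZMod.intCast_zmod_eq_zero_iff_dvd]
          push_cast
          rw [hq, hr, hp]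
          simp only [ZMod.coe_valMinAbs]
          ring
        have hbig : (N : ℤ) ≤ |q - (r - p)| := by
          have := Int.le_of_dvd (abs_pos.mpr (sub_ne_zero.mpr hc)) ((dvd_abs _ _).mpr hmod)
          exact this
        have hbig' : (N : ℝ) ≤ |(q : ℝ) - (r - p)| := by exact_mod_cast hbig
        have hrb := vma_bound (j - i)
        have hqb := vma_bound (j - k)
        rw [← hr] at hrb
        rw [← hq] at hqb
        have t1 : |(q : ℝ) - (r - p)| ≤ |(q : ℝ)| + |(r : ℝ)| + |(p : ℝ)| := by
          have := abs_sub (q : ℝ) (r - p)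
          have := abs_sub (r : ℝ) p
          linarith
        have t2 : |(q : ℝ) - (r - p)| ≤ |(q : ℝ)| + |(r : ℝ) - p| := abs_sub _ _
        have hanti : w (r - p) ≤ w q := by
          refine hw.anti _ _ ?_
          have : |(q : ℝ)| ≤ |(r : ℝ) - p| := by linarith
          exact_mod_cast this
        have hb : ‖B k q - B i (r - p)‖ ≤ 2 * Kb * w q ^ 2 := by
          refine (norm_sub_le _ _).trans ?_
          have : w (r - p) ^ 2 ≤ w q ^ 2 := by
            have := (hw.pos (r - p)).le
            gcongr
          nlinarith [hB k q, hB i (r - p)]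
        have hsm := hsmall p q (by linarith)
        calc w p * ‖B k q - B i (r - p)‖ ≤ w p * (2 * Kb * w q ^ 2) := by gcongr
          _ = 2 * Kb * w q * (w p * w q) := by ring
          _ ≤ 2 * Kb * w q * (2 * δ) := by gcongr
          _ ≤ 4 * δ * (L + Kb) * w q := by
            have : 0 ≤ L * δ * w q := by positivity
            nlinarith
    calc ‖A p‖ * ‖B k q - B i (r - p)‖ ≤ (Ka * w p ^ 2) * ‖B k q - B i (r - p)‖ := by
          gcongr; exact hA p
      _ = Ka * w p * (w p * ‖B k q - B i (r - p)‖) := by ring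
      _ ≤ Ka * w p * (4 * δ * (L + Kb) * w q) := by gcongr
      _ = _ := by ring
  · have hm : ∀ m : ℤ, m ∉ s → ‖g m‖ ≤ 4 * δ * Ka * (L + Kb) * (w m * w (r - m)) := by
      intro m hm
      have hbig : (N : ℝ) ≤ 2 * |(m : ℝ)| := by
        by_contra hcon
        apply hm
        have hcon' : 2 * |m| < (N : ℤ) := by
          push Not at hcon; exact_mod_cast hcon
        rw [hs, Finset.mem_image]
        refine ⟨(m : ZMod N) + i, Finset.mem_univ _, ?_⟩
        simp only [hι, add_sub_cancel_right]
        rw [ZMod.valMinAbs_spec]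
        refine ⟨rfl, ?_, ?_⟩ <;> rcases abs_cases m with h | h <;> omega
      have hsm := hsmall m (r - m) (by linarith [abs_nonneg (((r - m : ℤ)) : ℝ)])
      refine (hgb m).trans ?_
      calc Ka * Kb * (w m ^ 2 * w (r - m) ^ 2) = Ka * Kb * (w m * w (r - m)) * (w m * w (r - m)) := by
            ring
        _ ≤ Ka * Kb * (w m * w (r - m)) * (2 * δ) := by
            have := hww m
            gcongr
        _ ≤ 4 * δ * Ka * (L + Kb) * (w m * w (r - m)) := by
            have h0 := (hww m).le
            have h1 : 0 ≤ δ * Ka * L * (w m * w (r - m)) := by positivity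
            have h2 : 0 ≤ δ * Ka * Kb * (w m * w (r - m)) := by positivity
            nlinarith
    have hsumR : Summable fun m => 4 * δ * Ka * (L + Kb) * (w m * w (r - m)) :=
      (conv_summable hw r).mul_left _
    rw [← tsum_mul_left]
    have hnn : ∀ m, 0 ≤ 4 * δ * Ka * (L + Kb) * (w m * w (r - m)) := fun m => by
      have := (hww m).le
      positivity
    refine (tsum_of_norm_bounded (hsumR.subtype _).hasSum fun m => hm m.1 ?_).trans ?_
    · exact m.2
    · exact hsumR.tsum_subtype_le _ _ hnn

lemma parseval_poly (ε : ℤ) (hε : ε ≠ 0) (Q : ℕ) (Y : ℕ → ℂ) :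
    ∫ u : UnitAddCircle, ‖∑ p ∈ Finset.range Q, Y p * fourier (-(ε * p)) u‖ ^ 2
      = ∑ p ∈ Finset.range Q, ‖Y p‖ ^ 2 := by
  have horth : ∀ n : ℤ, ∫ u : UnitAddCircle, (fourier n u : ℂ) = if n = 0 then 1 else 0 := by
    intro n
    have := congrFun (fourierCoeff_fourier (T := 1) n) 0
    rw [fourierCoeff, AddCircle.integral_haarAddCircle] at this
    simpa [Pi.single_apply, eq_comm] using this
  have key : ∫ u : UnitAddCircle, ((‖∑ p ∈ Finset.range Q, Y p * fourier (-(ε * p)) u‖ ^ 2 : ℝ) : ℂ)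
      = ((∑ p ∈ Finset.range Q, ‖Y p‖ ^ 2 : ℝ) : ℂ) := by
    have e : ∀ u : UnitAddCircle,
        ((‖∑ p ∈ Finset.range Q, Y p * fourier (-(ε * p)) u‖ ^ 2 : ℝ) : ℂ)
        = ∑ p ∈ Finset.range Q, ∑ p' ∈ Finset.range Q,
          (Y p * (starRingEnd ℂ) (Y p')) * fourier (ε * (p' - p)) u := by
      intro u
      push_cast
      rw [← Complex.mul_conj', map_sum, Finset.sum_mul_sum]
      refine Finset.sum_congr rfl fun p _ => Finset.sum_congr rfl fun p' _ => ?_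
      rw [map_mul, ← fourier_neg, neg_neg]
      have : ε * ((p' : ℤ) - p) = -(ε * p) + ε * p' := by ring
      rw [this, fourier_add]
      ring
    simp only [e]
    rw [integral_finsetSum]
    · push_cast
      refine Finset.sum_congr rfl fun p hp => ?_
      rw [integral_finsetSum]
      · simp only [integral_const_mul, horth]
        rw [Finset.sum_eq_single p]
        · simp [Complex.mul_conj']
        · intro b _ hb
          have : ε * ((b : ℤ) - p) ≠ 0 := mul_ne_zero hε (sub_ne_zero.mpr (by exact_mod_cast hb))
          simp [this]
        · exact fun h => absurd hp h
      · intro p' _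
        exact Continuous.integrable_of_hasCompactSupport (by fun_prop) (HasCompactSupport.of_compactSpace _)
    · intro p _
      exact Continuous.integrable_of_hasCompactSupport (by fun_prop) (HasCompactSupport.of_compactSpace _)
  exact Complex.ofReal_injective (integral_complex_ofReal.symm.trans key)

lemma hankel (ε : ℤ) (hε : ε ≠ 0) (Q : ℕ) (h : UnitAddCircle → ℂ) (hc : Continuous h) (H : ℝ)
    (hH : ∀ u, ‖h u‖ ≤ H) (Y Z : ℕ → ℂ) :
    ‖∑ p ∈ Finset.range Q, ∑ p' ∈ Finset.range Q,
      Y p * (∫ u : UnitAddCircle, h u * fourier (-(ε * (p + p' + 1))) u) * Z p'‖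
      ≤ H / 2 * (∑ p ∈ Finset.range Q, ‖Y p‖ ^ 2 + ∑ p ∈ Finset.range Q, ‖Z p‖ ^ 2) := by
  have h_cic : ∀ {F : UnitAddCircle → ℂ}, Continuous F → Integrable F := fun hF =>
    Continuous.integrable_of_hasCompactSupport hF (HasCompactSupport.of_compactSpace _)
  have h_cir : ∀ {F : UnitAddCircle → ℝ}, Continuous F → Integrable F := fun hF =>
    Continuous.integrable_of_hasCompactSupport hF (HasCompactSupport.of_compactSpace _)
  have hH0 : 0 ≤ H := (norm_nonneg _).trans (hH 0)
  set P : UnitAddCircle → ℂ := fun u => ∑ p ∈ Finset.range Q, Y p * fourier (-(ε * p)) u with hP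
  set R : UnitAddCircle → ℂ := fun u => ∑ p ∈ Finset.range Q, Z p * fourier (-(ε * p)) u with hR
  have hPc : Continuous P := by fun_prop
  have hRc : Continuous R := by fun_prop
  have e : ∑ p ∈ Finset.range Q, ∑ p' ∈ Finset.range Q,
      Y p * (∫ u : UnitAddCircle, h u * fourier (-(ε * (p + p' + 1))) u) * Z p'
      = ∫ u : UnitAddCircle, (h u * fourier (-ε) u) * (P u * R u) := by
    have e1 : ∀ u, (h u * fourier (-ε) u) * (P u * R u)
        = ∑ p ∈ Finset.range Q, ∑ p' ∈ Finset.range Q,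
            Y p * (h u * fourier (-(ε * (p + p' + 1))) u) * Z p' := by
      intro u
      simp only [hP, hR]
      rw [Finset.sum_mul_sum, Finset.mul_sum]
      refine Finset.sum_congr rfl fun p _ => ?_
      rw [Finset.mul_sum]
      refine Finset.sum_congr rfl fun p' _ => ?_
      have : -(ε * ((p : ℤ) + p' + 1)) = -ε + (-(ε * p) + -(ε * p')) := by ring
      rw [this, fourier_add, fourier_add]
      ring
    simp only [e1]
    rw [integral_finsetSum]
    · refine Finset.sum_congr rfl fun p hp => ?_
      rw [integral_finsetSum]
      · refine Finset.sum_congr rfl fun p' hp' => ?_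
        rw [integral_mul_const, integral_const_mul]
      · intro p' _
        exact h_cic (by fun_prop)
    · intro p _
      exact h_cic (by fun_prop)
  rw [e]
  calc ‖∫ u : UnitAddCircle, (h u * fourier (-ε) u) * (P u * R u)‖
      ≤ ∫ u : UnitAddCircle, H / 2 * (‖P u‖ ^ 2 + ‖R u‖ ^ 2) := by
        refine norm_integral_le_of_norm_le (h_cir (by fun_prop)) (Filter.Eventually.of_forall fun u => ?_)
        have hf : ‖(fourier (-ε) u : ℂ)‖ = 1 := by rw [fourier_apply]; exact Circle.norm_coe _
        rw [norm_mul, norm_mul, norm_mul, hf, mul_one]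
        have := mul_le_mul_of_nonneg_right (hH u) (mul_nonneg (norm_nonneg (P u)) (norm_nonneg (R u)))
        nlinarith [mul_nonneg hH0 (sq_nonneg (‖P u‖ - ‖R u‖))]
    _ = _ := by
        rw [integral_const_mul, integral_add (h_cir (by fun_prop)) (h_cir (by fun_prop))]
        simp only [hP, hR]
        rw [parseval_poly ε hε, parseval_poly ε hε]

/-- telescoped near-diagonal part -/
noncomputable def Mp {N : ℕ} (Q : ℕ) (β : ZMod N → ℤ → ℂ) (j k : ZMod N) : ℂ :=
  ∑ p ∈ Finset.range Q, ∑ p' ∈ Finset.range Q,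
    if k = j + ((p : ZMod N) + p' + 1) then
      β (j + p) (p + p' + 1) - β (j + p + 1) (p + p' + 1) else 0

lemma Mp_Bd {N : ℕ} [NeZero N] (Q : ℕ) (β : ZMod N → ℤ → ℂ) (H : ℝ)
    (hH : ∀ (t : ZMod N) (Y Z : ℕ → ℂ), ‖∑ p ∈ Finset.range Q, ∑ p' ∈ Finset.range Q,
      Y p * (β t (p + p' + 1) - β (t + 1) (p + p' + 1)) * Z p'‖
      ≤ H / 2 * (∑ p ∈ Finset.range Q, ‖Y p‖ ^ 2 + ∑ p ∈ Finset.range Q, ‖Z p‖ ^ 2)) :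
    Bd (Mp Q β) (H * Q) := by
  intro y f
  have e1 : ∀ j : ZMod N, ∑ k, y j * Mp Q β j k * f k
      = ∑ p ∈ Finset.range Q, ∑ p' ∈ Finset.range Q,
        y j * (β (j + p) (p + p' + 1) - β (j + p + 1) (p + p' + 1)) *
          f (j + ((p : ZMod N) + p' + 1)) := by
    intro j
    simp only [Mp, Finset.mul_sum, Finset.sum_mul]
    rw [Finset.sum_comm]
    refine Finset.sum_congr rfl fun p _ => ?_
    rw [Finset.sum_comm]
    refine Finset.sum_congr rfl fun p' _ => ?_
    rw [Finset.sum_eq_single (j + ((p : ZMod N) + p' + 1))]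
    · simp
    · intro b _ hb
      simp [hb]
    · simp
  have e2 : ∑ j, ∑ k, y j * Mp Q β j k * f k
      = ∑ t : ZMod N, ∑ p ∈ Finset.range Q, ∑ p' ∈ Finset.range Q,
        y (t - p) * (β t (p + p' + 1) - β (t + 1) (p + p' + 1)) * f (t + 1 + p') := by
    simp only [e1]
    rw [Finset.sum_comm]
    rw [Finset.sum_comm (s := Finset.univ)]
    refine Finset.sum_congr rfl fun p _ => ?_
    rw [← Equiv.sum_comp (Equiv.subRight (p : ZMod N))]
    refine Finset.sum_congr rfl fun t _ => Finset.sum_congr rfl fun p' _ => ?_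
    simp only [Equiv.subRight_apply, sub_add_cancel]
    congr 2
    ring
  rw [e2]
  calc _ ≤ ∑ t : ZMod N, H / 2 * (∑ p ∈ Finset.range Q, ‖y (t - p)‖ ^ 2 +
        ∑ p ∈ Finset.range Q, ‖f (t + 1 + p)‖ ^ 2) :=
        norm_sum_le_of_le _ fun t _ => hH t (fun p => y (t - p)) (fun p => f (t + 1 + p))
    _ = _ := by
        rw [← Finset.mul_sum, Finset.sum_add_distrib, Finset.sum_comm,
          Finset.sum_comm (f := fun (t : ZMod N) (p : ℕ) => ‖f (t + 1 + p)‖ ^ 2)]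
        have h1 : ∀ p : ℕ, ∑ t : ZMod N, ‖y (t - p)‖ ^ 2 = ∑ t, ‖y t‖ ^ 2 := fun p =>
          Equiv.sum_comp (Equiv.subRight (p : ZMod N)) (fun t => ‖y t‖ ^ 2)
        have h2 : ∀ p : ℕ, ∑ t : ZMod N, ‖f (t + 1 + p)‖ ^ 2 = ∑ t, ‖f t‖ ^ 2 := fun p => by
          simp only [add_assoc]
          exact Equiv.sum_comp (Equiv.addRight (1 + (p : ZMod N))) (fun t => ‖f t‖ ^ 2)
        simp only [h1, h2, Finset.sum_const, Finset.card_range, nsmul_eq_mul]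
        ring

lemma Mp_cond {N : ℕ} [NeZero N] {Q : ℕ} (hQ : 4 * Q ≤ N) {p p' : ℕ} (hp : p < Q) (hp' : p' < Q)
    (j k : ZMod N) : k = j + ((p : ZMod N) + p' + 1) ↔ (k - j).valMinAbs = p + p' + 1 := by
  constructor
  · rintro rfl
    rw [add_sub_cancel_left]
    have : ((p : ZMod N) + p' + 1) = ((p + p' + 1 : ℕ) : ZMod N) := by push_cast; rfl
    rw [this, ZMod.valMinAbs_natCast_of_le_half (by omega)]
    push_cast; rfl
  · intro h
    have := congrArg (fun z : ℤ => (z : ZMod N)) h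
    simp only [ZMod.coe_valMinAbs] at this
    push_cast at this
    rw [← this]; ring

lemma Mp_nonpos {N : ℕ} [NeZero N] {Q : ℕ} (hQ : 4 * Q ≤ N) (β : ZMod N → ℤ → ℂ) (j k : ZMod N)
    (hr : (k - j).valMinAbs ≤ 0) : Mp Q β j k = 0 := by
  refine Finset.sum_eq_zero fun p hp => Finset.sum_eq_zero fun p' hp' => if_neg ?_
  rw [Mp_cond hQ (Finset.mem_range.1 hp) (Finset.mem_range.1 hp')]
  omega

lemma Mp_pos {N : ℕ} [NeZero N] {Q : ℕ} (hQ : 4 * Q ≤ N) (β : ZMod N → ℤ → ℂ) (j k : ZMod N)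
    (n : ℕ) (hr : (k - j).valMinAbs = n) : Mp Q β j k =
      ∑ p ∈ Finset.Ico (n - Q) (min Q n), (β (j + p) n - β (j + (p + 1 : ℕ)) n) := by
  have : Finset.Ico (n - Q) (min Q n) = (Finset.range Q).filter (fun p => p < n ∧ n ≤ p + Q) := by
    ext p; simp; omega
  rw [this, Finset.sum_filter]
  refine Finset.sum_congr rfl fun p hp => ?_
  have hp1 := Finset.mem_range.1 hp
  split_ifs with h
  · rw [Finset.sum_eq_single (n - p - 1)]
    · have h1 : (p : ℤ) + (n - p - 1 : ℕ) + 1 = n := by omega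
      rw [if_pos ((Mp_cond hQ hp1 (by omega) j k).2 (by omega)), h1]
      push_cast
      rw [add_assoc]
    · intro p' hp' hne
      rw [if_neg]
      rw [Mp_cond hQ hp1 (Finset.mem_range.1 hp')]
      omega
    · intro h'
      exact absurd (Finset.mem_range.2 (by omega)) h'
  · refine Finset.sum_eq_zero fun p' hp' => if_neg ?_
    have := Finset.mem_range.1 hp'
    rw [Mp_cond hQ hp1 this]
    omega

lemma tele (F : ℕ → ℂ) {lo hi : ℕ} (h : lo ≤ hi) :
    ∑ p ∈ Finset.Ico lo hi, (F p - F (p + 1)) = F lo - F hi := by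
  rw [Finset.sum_Ico_eq_sub _ h, Finset.sum_range_sub', Finset.sum_range_sub']
  ring

lemma Mp_near {N : ℕ} [NeZero N] {Q : ℕ} (hQ : 4 * Q ≤ N) (β : ZMod N → ℤ → ℂ) (j k : ZMod N)
    (hr : 0 < (k - j).valMinAbs) (hr' : (k - j).valMinAbs ≤ Q) :
    Mp Q β j k = β j (k - j).valMinAbs - β k (k - j).valMinAbs := by
  obtain ⟨n, hn⟩ := Int.eq_ofNat_of_zero_le hr.le
  rw [Mp_pos hQ β j k n hn, tele (fun p => β (j + p) n) (by omega)]
  have h1 : n - Q = 0 := by omega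
  have h2 : min Q n = n := by omega
  have h3 : j + (n : ZMod N) = k := by
    have := congrArg (fun z : ℤ => (z : ZMod N)) hn
    simp only [ZMod.coe_valMinAbs] at this
    push_cast at this
    rw [← this]; ring
  rw [h1, h2, h3, hn]
  simp

lemma Mp_bound {N : ℕ} [NeZero N] {Q : ℕ} (hQ : 4 * Q ≤ N) (β : ZMod N → ℤ → ℂ) (j k : ZMod N)
    (K : ℝ) (hK : ∀ i, ‖β i (k - j).valMinAbs‖ ≤ K) : ‖Mp Q β j k‖ ≤ 2 * K := by
  have hK0 : 0 ≤ K := (norm_nonneg _).trans (hK 0)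
  rcases le_or_gt (k - j).valMinAbs 0 with h | h
  · rw [Mp_nonpos hQ β j k h]; simpa
  obtain ⟨n, hn⟩ := Int.eq_ofNat_of_zero_le h.le
  rw [Mp_pos hQ β j k n hn]
  rw [hn] at hK
  rcases le_total (n - Q) (min Q n) with h | h
  · rw [tele (fun p => β (j + p) n) h]
    refine (norm_sub_le _ _).trans ?_
    linarith [hK (j + ((n - Q : ℕ) : ZMod N)), hK (j + ((min Q n : ℕ) : ZMod N))]
  · rw [Finset.Ico_eq_empty_of_le h]; simpa

lemma core2 {N : ℕ} [NeZero N] {w : ℤ → ℝ} (hw : GoodW w) {Q : ℕ} (hQ : 4 * Q ≤ N)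
    (β : ZMod N → ℤ → ℂ) (H Kb δ : ℝ) (hKb : 0 ≤ Kb) (hδ : 0 < δ) (hδQ : 1 ≤ δ * (Q + 1))
    (hβ : ∀ i m, ‖β i m‖ ≤ Kb * w m ^ 2)
    (h1 : Bd (Mp Q β) (H * Q)) (h2 : Bd (Mp Q (fun i m => β i (-m))) (H * Q)) :
    Bd (fun j k => β j (k - j).valMinAbs - β k (-(j - k).valMinAbs))
      (H * Q + H * Q + 6 * Kb * δ * ∑' m, w m) := by
  set β' : ZMod N → ℤ → ℂ := fun i m => β i (-m) with hβ'
  have h3 : Bd (fun j k => β j (k - j).valMinAbs - β k (-(j - k).valMinAbs) - Mp Q β j k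
      + Mp Q β' k j) (6 * Kb * δ * ∑' m, w m) := by
    refine Bd.schur (g := fun d => 6 * Kb * δ * w d.valMinAbs) ?_ ?_
    · intro j k
      set r := (k - j).valMinAbs with hr
      have hwr := hw.pos r
      have habs : |(j - k).valMinAbs| = |r| := by
        have := ZMod.natAbs_valMinAbs_neg (k - j)
        rw [neg_sub] at this
        rw [Int.abs_eq_natAbs, Int.abs_eq_natAbs, this]
      have hwa : w (j - k).valMinAbs = w r := le_antisymm (hw.anti _ _ habs.ge) (hw.anti _ _ habs.le)
      have hwn : ∀ m, w (-m) = w m := fun m =>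
        le_antisymm (hw.anti _ _ (by simp)) (hw.anti _ _ (by simp))
      have hrhs : 0 ≤ 6 * Kb * δ * w r := by positivity
      rcases le_or_gt |r| Q with hle | hgt
      · have hNpos : 0 < N := NeZero.pos N
        have hneg : (j - k).valMinAbs = -r := by
          rw [ZMod.valMinAbs_spec]
          refine ⟨?_, ?_, ?_⟩
          · push_cast; rw [hr, ZMod.coe_valMinAbs]; ring
          · rcases abs_cases r with h | h <;> omega
          · rcases abs_cases r with h | h <;> omega
        suffices hz : β j r - β k (-(j - k).valMinAbs) - Mp Q β j k + Mp Q β' k j = 0 by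
          rw [hz, norm_zero]; exact hrhs
        rw [abs_le] at hle
        rcases lt_trichotomy r 0 with h | h | h
        · rw [Mp_nonpos hQ β j k h.le, Mp_near hQ β' k j (by omega) (by omega)]
          simp only [hβ', hneg, neg_neg]; ring
        · have hjk : j = k := by
            have := (ZMod.valMinAbs_eq_zero (k - j)).1 h
            exact (sub_eq_zero.1 this).symm
          rw [Mp_nonpos hQ β j k h.le, Mp_nonpos hQ β' k j (by omega), hneg, hjk]
          simp
        · rw [Mp_nonpos hQ β' k j (by omega), Mp_near hQ β j k h hle.2, hneg, neg_neg]
          ring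
      · have b1 := hβ j r
        have b2 := hβ k (-(j - k).valMinAbs)
        rw [hwn, hwa] at b2
        have b3 := Mp_bound hQ β j k (Kb * w r ^ 2) (fun i => hβ i _)
        have b4 := Mp_bound hQ β' k j (Kb * w r ^ 2) (fun i => by
          have := hβ i (-(j - k).valMinAbs)
          rwa [hwn, hwa] at this)
        have hwδ : w r ≤ δ := by
          have hle := hw.le r
          have hq : (Q : ℝ) ≤ |(r : ℝ)| := by exact_mod_cast hgt.le
          have : w r * (1 + Q) ≤ 1 := le_trans (by gcongr) hle
          have hQ0 : (0 : ℝ) < Q + 1 := by positivity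
          by_contra hcon
          push Not at hcon
          nlinarith [mul_lt_mul_of_pos_right hcon hQ0]
        have b5 : Kb * w r ^ 2 ≤ Kb * δ * w r := by
          have := mul_le_mul_of_nonneg_left hwδ (mul_nonneg hKb hwr.le)
          nlinarith
        refine (norm_add_le _ _).trans ?_
        have := norm_sub_le (β j r - β k (-(j - k).valMinAbs)) (Mp Q β j k)
        have := norm_sub_le (β j r) (β k (-(j - k).valMinAbs))
        linarith
    · rw [← Finset.mul_sum]
      have := sum_inj_le hw (fun d : ZMod N => d.valMinAbs) ZMod.injective_valMinAbs
      gcongr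
  have := (h1.add h2.transpose.neg).add h3
  convert this using 3
  ring

lemma volreal : (volume : Measure UnitAddCircle).real Set.univ = 1 := by
  simp [Measure.real]

lemma cont_int {F : UnitAddCircle → ℂ} (hF : Continuous F) : Integrable F :=
  Continuous.integrable_of_hasCompactSupport hF (HasCompactSupport.of_compactSpace _)

lemma tauRep_eq {N : ℕ} [NeZero N] (m : ℤ) : tauRep N m = (m : ZMod N).valMinAbs := by
  symm
  have hN : (0 : ℤ) < N := by exact_mod_cast NeZero.pos N
  have h1 := Int.emod_nonneg m hN.ne'
  have h2 := Int.emod_lt_of_pos m hN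
  rw [ZMod.valMinAbs_spec]
  unfold tauRep
  split_ifs with h
  · refine ⟨?_, ?_, ?_⟩
    · simp
    · omega
    · omega
  · refine ⟨?_, ?_, ?_⟩
    · simp
    · omega
    · omega

lemma Dmat_eq {N : ℕ} [NeZero N] (h : UnitAddCircle → UnitAddCircle → ℂ) (i j : Fin N) :
    Dmat N h i j = fhat h (ZMod.toAddCircle ((i : ℕ) : ZMod N))
      (((j : ℕ) : ZMod N) - ((i : ℕ) : ZMod N)).valMinAbs := by
  have h1 : ZMod.toAddCircle ((i : ℕ) : ZMod N) = (((i : ℕ) : ℝ) / (N : ℝ) : ℝ) := by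
    have := ZMod.toAddCircle_intCast (N := N) ((i : ℕ) : ℤ)
    push_cast at this
    simpa using this
  unfold Dmat
  rw [Matrix.of_apply, tauRep_eq, h1]
  push_cast
  rfl

lemma dist_toAddCircle {N : ℕ} [NeZero N] (i k : ZMod N) :
    dist (ZMod.toAddCircle k) (ZMod.toAddCircle i) ≤ |((k - i).valMinAbs : ℝ)| / N := by
  rw [dist_eq_norm, ← map_sub]
  conv_lhs => rw [← ZMod.coe_valMinAbs (k - i)]
  rw [ZMod.toAddCircle_intCast]
  have : |((k - i).valMinAbs : ℝ)| / N = |((k - i).valMinAbs : ℝ) / N| := by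
    rw [abs_div, Nat.abs_cast]
  rw [this, ← Real.norm_eq_abs]
  exact QuotientAddGroup.norm_mk_le_norm

lemma fhat_sub_le {b : UnitAddCircle → UnitAddCircle → ℂ}
    (hb : Continuous (fun p : UnitAddCircle × UnitAddCircle => b p.1 p.2)) {L : ℝ}
    (hL : ∀ (s s' u : UnitAddCircle), ‖b s u - b s' u‖ ≤ L * dist s s')
    (s s' : UnitAddCircle) (m : ℤ) : ‖fhat b s m - fhat b s' m‖ ≤ L * dist s s' := by
  have hc : ∀ s, Continuous (b s) := fun s => hb.comp (by fun_prop : Continuous fun u => (s, u))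
  unfold fhat
  have h1 := hc s
  have h2 := hc s'
  rw [← integral_sub (cont_int (by fun_prop)) (cont_int (by fun_prop))]
  have := norm_integral_le_of_norm_le_const (μ := (volume : Measure UnitAddCircle))
    (f := fun u => b s u * fourier (-m) u - b s' u * fourier (-m) u) (C := L * dist s s')
    (Filter.Eventually.of_forall fun u => by
      have hf : ‖(fourier (-m) u : ℂ)‖ = 1 := by rw [fourier_apply]; exact Circle.norm_coe _
      rw [← sub_mul, norm_mul, hf, mul_one]; exact hL s s' u)
  rwa [volreal, mul_one] at this

lemma fhat_conj (b : UnitAddCircle → UnitAddCircle → ℂ) (s : UnitAddCircle) (k : ℤ) :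
    fhat (fun s u => (starRingEnd ℂ) (b s u)) s k = (starRingEnd ℂ) (fhat b s (-k)) := by
  unfold fhat
  rw [← integral_conj]
  refine integral_congr_ae (Filter.Eventually.of_forall fun u => ?_)
  simp only [map_mul, ← fourier_neg, neg_neg]

lemma fhat_mul {w : ℤ → ℝ} (hw : GoodW w) {a b : UnitAddCircle → UnitAddCircle → ℂ}
    (ha : Continuous (fun p : UnitAddCircle × UnitAddCircle => a p.1 p.2))
    (hb : Continuous (fun p : UnitAddCircle × UnitAddCircle => b p.1 p.2)) {Ka : ℝ}
    (hKa : ∀ s m, ‖fhat a s m‖ ≤ Ka * w m ^ 2) (s : UnitAddCircle) (r : ℤ) :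
    fhat (fun s u => a s u * b s u) s r = ∑' m, fhat a s m * fhat b s (r - m) := by
  have hac : Continuous (a s) := ha.comp (by fun_prop : Continuous fun u => (s, u))
  have hbc : Continuous (b s) := hb.comp (by fun_prop : Continuous fun u => (s, u))
  let f : C(UnitAddCircle, ℂ) := ⟨a s, hac⟩
  have hcoef : ∀ m, fourierCoeff f m = fhat a s m := by
    intro m
    rw [fourierCoeff, AddCircle.integral_haarAddCircle, fhat]
    simp [f, mul_comm]
  have hK0 : 0 ≤ Ka := by
    have := (norm_nonneg _).trans (hKa 0 0)
    nlinarith [pow_pos (hw.pos 0) 2]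
  have hns : Summable fun m => ‖fhat a s m‖ := by
    refine Summable.of_nonneg_of_le (fun _ => norm_nonneg _) (fun m => ?_) (hw.summ.mul_left Ka)
    refine (hKa s m).trans (mul_le_mul_of_nonneg_left ?_ hK0)
    nlinarith [hw.pos m, hw.le_one m]
  have hsum : Summable (fourierCoeff f) := by
    rw [funext hcoef]; exact hns.of_norm
  have hpt := has_pointwise_sum_fourier_series_of_summable hsum
  obtain ⟨M, hM⟩ := (isCompact_range hbc).isBounded.exists_norm_le
  have hM' : ∀ u, ‖b s u‖ ≤ M := fun u => hM _ ⟨u, rfl⟩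
  have hfn : ∀ (n : ℤ) (u : UnitAddCircle), ‖(fourier n u : ℂ)‖ = 1 := fun n u => by
    rw [fourier_apply]; exact Circle.norm_coe _
  have key := hasSum_integral_of_summable_integral_norm (μ := (volume : Measure UnitAddCircle))
    (F := fun (m : ℤ) u => fhat a s m * (b s u * fourier (-(r - m)) u))
    (fun m => cont_int (by fun_prop)) (by
      refine Summable.of_nonneg_of_le (fun m => integral_nonneg fun _ => norm_nonneg _) (fun m => ?_)
        (hns.mul_right M)
      have := integral_mono_of_nonneg (μ := (volume : Measure UnitAddCircle))
        (f := fun u => ‖fhat a s m * (b s u * fourier (-(r - m)) u)‖)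
        (g := fun u => ‖fhat a s m‖ * M) (Filter.Eventually.of_forall fun u => norm_nonneg _)
        (integrable_const _) (Filter.Eventually.of_forall fun u => by
          simp only [norm_mul, hfn, mul_one]
          exact mul_le_mul_of_nonneg_left (hM' u) (norm_nonneg _))
      rwa [integral_const, volreal, one_smul] at this)
  simp only [integral_const_mul] at key
  have e : ∀ u, ∑' m : ℤ, fhat a s m * (b s u * fourier (-(r - m)) u)
      = a s u * b s u * fourier (-r) u := by
    intro u
    have h1 := (hpt u).mul_right (b s u * fourier (-r) u)
    rw [mul_assoc]
    refine Eq.trans ?_ h1.tsum_eq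
    refine tsum_congr fun m => ?_
    rw [hcoef, smul_eq_mul]
    have : -(r - m) = m + -r := by ring
    rw [this, fourier_add]
    ring
  simp only [e] at key
  exact key.tsum_eq.symm

lemma goodW_rpow {α : ℝ} (hα : 2 < α) : GoodW fun m : ℤ => (1 + |(m : ℝ)|) ^ (-(α / 2)) where
  pos m := by positivity
  le m := by
    have h1 : (1 : ℝ) ≤ 1 + |(m : ℝ)| := by linarith [abs_nonneg (m : ℝ)]
    have := Real.rpow_le_rpow_of_exponent_le h1 (by linarith : -(α / 2) ≤ -1)
    rw [Real.rpow_neg_one] at this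
    calc _ ≤ (1 + |(m : ℝ)|)⁻¹ * (1 + |(m : ℝ)|) := by gcongr
      _ = 1 := inv_mul_cancel₀ (by positivity)
  anti m n h := by
    have h' : |(m : ℝ)| ≤ |(n : ℝ)| := by exact_mod_cast h
    exact Real.rpow_le_rpow_of_nonpos (by positivity) (by linarith) (by linarith)
  summ := by
    refine Summable.of_norm_bounded_eventually
      (Real.summable_abs_int_rpow (b := α / 2) (by linarith)) ?_
    refine (Set.finite_singleton (0 : ℤ)).subset ?_
    intro m hm
    by_contra hne
    apply hm
    have : (0 : ℝ) < |(m : ℝ)| := abs_pos.mpr (by exact_mod_cast hne)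
    show ‖(1 + |(m : ℝ)|) ^ (-(α / 2))‖ ≤ _
    rw [Real.norm_of_nonneg (by positivity)]
    exact Real.rpow_le_rpow_of_nonpos this (by linarith) (by linarith)

lemma bound_w {α : ℝ} (x K : ℝ) (k : ℤ) (h : x * (1 + |(k : ℝ)|) ^ α ≤ K) :
    x ≤ K * ((1 + |(k : ℝ)|) ^ (-(α / 2))) ^ 2 := by
  have hp : (0 : ℝ) < 1 + |(k : ℝ)| := by positivity
  have : ((1 + |(k : ℝ)|) ^ (-(α / 2))) ^ 2 = ((1 + |(k : ℝ)|) ^ α)⁻¹ := by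
    rw [sq, ← Real.rpow_add hp, ← Real.rpow_neg hp.le]; congr 1; ring
  rw [this, ← div_eq_mul_inv, le_div_iff₀ (by positivity)]
  exact h

open scoped Matrix.Norms.L2Operator in
lemma l2_sub_le {N : ℕ} (A B C D : Matrix (Fin N) (Fin N) ℂ) :
    l2OpNorm (A * Bᴴ - D) ≤ l2OpNorm A * l2OpNorm (B - Cᴴ) + l2OpNorm (A * C - D) := by
  have h : ∀ M : Matrix (Fin N) (Fin N) ℂ, l2OpNorm M = ‖M‖ := fun M => rfl
  simp only [h]
  have e : A * Bᴴ - D = A * (B - Cᴴ)ᴴ + (A * C - D) := by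
    rw [conjTranspose_sub, conjTranspose_conjTranspose, mul_sub]; abel
  rw [e]
  refine (norm_add_le _ _).trans (add_le_add ?_ le_rfl)
  refine (Matrix.l2_opNorm_mul _ _).trans ?_
  rw [Matrix.l2_opNorm_conjTranspose]

lemma D_norm {N : ℕ} [NeZero N] {w : ℤ → ℝ} (hw : GoodW w) {a : UnitAddCircle → UnitAddCircle → ℂ}
    {Ka : ℝ} (hK0 : 0 ≤ Ka) (hKa : ∀ s m, ‖fhat a s m‖ ≤ Ka * w m ^ 2) :
    l2OpNorm (Dmat N a) ≤ Ka * ∑' m, w m := by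
  refine opNorm_le_of_Bd' (mul_nonneg hK0 (tsum_nonneg fun m => (hw.pos m).le))
    (fun i j => fhat a (ZMod.toAddCircle i) (j - i).valMinAbs) (fun i j => Dmat_eq a i j) ?_
  refine Bd.schur (g := fun d => Ka * w d.valMinAbs) (fun i j => ?_) ?_
  · refine (hKa _ _).trans (mul_le_mul_of_nonneg_left ?_ hK0)
    nlinarith [hw.pos (j - i).valMinAbs, hw.le_one (j - i).valMinAbs]
  · rw [← Finset.mul_sum]
    exact mul_le_mul_of_nonneg_left
      (sum_inj_le hw (fun d : ZMod N => d.valMinAbs) ZMod.injective_valMinAbs) hK0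

lemma part1 {N : ℕ} [NeZero N] {w : ℤ → ℝ} (hw : GoodW w) {a b : UnitAddCircle → UnitAddCircle → ℂ}
    (ha : Continuous (fun p : UnitAddCircle × UnitAddCircle => a p.1 p.2))
    (hb : Continuous (fun p : UnitAddCircle × UnitAddCircle => b p.1 p.2)) {δ L Ka Kb : ℝ}
    (hδ : 0 < δ) (hδN : δ ^ 2 * N = 1) (hL0 : 0 ≤ L) (hKa0 : 0 ≤ Ka) (hKb0 : 0 ≤ Kb)
    (hL : ∀ (s s' u : UnitAddCircle), ‖b s u - b s' u‖ ≤ L * dist s s')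
    (hKa : ∀ s m, ‖fhat a s m‖ ≤ Ka * w m ^ 2) (hKb : ∀ s m, ‖fhat b s m‖ ≤ Kb * w m ^ 2) :
    l2OpNorm (Dmat N a * Dmat N b - Dmat N (fun s u => a s u * b s u)) ≤
      4 * δ * Ka * (L + Kb) * (2 * (∑' m, w m) ^ 2) := by
  let σ : ZMod N → UnitAddCircle := fun i => ZMod.toAddCircle i
  refine opNorm_le_of_Bd' (by positivity)
    (fun i j => ∑ k, fhat a (σ i) (k - i).valMinAbs * fhat b (σ k) (j - k).valMinAbs -
        ∑' m, fhat a (σ i) m * fhat b (σ i) ((j - i).valMinAbs - m)) (fun i j => ?_) ?_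
  · rw [Matrix.sub_apply, Matrix.mul_apply, Dmat_eq, fhat_mul hw ha hb hKa]
    congr 1
    let e : Fin N ≃ ZMod N := 
      { toFun := fun i => ((i : ℕ) : ZMod N)
        invFun := fun z => ⟨z.val, ZMod.val_lt z⟩
        left_inv := fun i => by ext; simp [ZMod.val_natCast, Nat.mod_eq_of_lt i.2]
        right_inv := fun z => by simp }
    rw [← e.sum_comp]
    refine Finset.sum_congr rfl fun k _ => ?_
    rw [Dmat_eq, Dmat_eq]
    rfl
  · refine Bd.schur (g := fun d => 4 * δ * Ka * (L + Kb) *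
      (∑ k : ZMod N, w k.valMinAbs * w (d - k).valMinAbs + ∑' m, w m * w (d.valMinAbs - m)))
      (fun i j => ?_) ?_
    · have := core1 hw (fhat a (σ i)) (fun k => fhat b (σ k)) δ L Ka Kb hδ hδN hL0 hKa0 hKb0
        (hKa _) (fun i m => hKb _ m) (fun i k m => (fhat_sub_le hb hL _ _ m).trans
          (mul_le_mul_of_nonneg_left (dist_toAddCircle i k) hL0)) i j
      refine this.trans_eq ?_
      have e : ∑ k : ZMod N, w (k - i).valMinAbs * w (j - k).valMinAbs
          = ∑ k : ZMod N, w k.valMinAbs * w (j - i - k).valMinAbs := by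
        rw [← Equiv.sum_comp (Equiv.subRight i) (fun k : ZMod N => w k.valMinAbs * w (j - i - k).valMinAbs)]
        refine Finset.sum_congr rfl fun k _ => ?_
        simp
      rw [e]
    · rw [← Finset.mul_sum, Finset.sum_add_distrib]
      refine mul_le_mul_of_nonneg_left ?_ (by positivity)
      linarith [sum_conv_le (N := N) hw, sum_conv1_le (N := N) hw]

lemma part2 {N : ℕ} [NeZero N] {w : ℤ → ℝ} (hw : GoodW w) {b : UnitAddCircle → UnitAddCircle → ℂ}
    (hb : Continuous (fun p : UnitAddCircle × UnitAddCircle => b p.1 p.2)) {δ L Kb : ℝ}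
    (hδ : 0 < δ) (hδN : δ ^ 2 * N = 1) (hL0 : 0 ≤ L) (hKb0 : 0 ≤ Kb)
    (hL : ∀ (s s' u : UnitAddCircle), ‖b s u - b s' u‖ ≤ L * dist s s')
    (hKb : ∀ s m, ‖fhat b s m‖ ≤ Kb * w m ^ 2)
    (hKb' : ∀ s m, ‖fhat (fun s u => (starRingEnd ℂ) (b s u)) s m‖ ≤ Kb * w m ^ 2) :
    l2OpNorm (Dmat N b - (Dmat N (fun s u => (starRingEnd ℂ) (b s u)))ᴴ) ≤
      (2 + 8 * ∑' m, w m) * δ * (L + Kb) := by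
  have hS : 0 ≤ ∑' m, w m := tsum_nonneg fun m => (hw.pos m).le
  have hNpos : (0 : ℝ) < N := by exact_mod_cast NeZero.pos N
  rcases lt_or_ge N 16 with hN | hN
  · have h1 := D_norm (N := N) hw hKb0 hKb
    have h2 := D_norm (N := N) hw hKb0 hKb'
    have h3 : l2OpNorm (Dmat N b - (Dmat N (fun s u => (starRingEnd ℂ) (b s u)))ᴴ) ≤
        l2OpNorm (Dmat N b) + l2OpNorm (Dmat N (fun s u => (starRingEnd ℂ) (b s u))) := by
      open scoped Matrix.Norms.L2Operator in
      have h : ∀ M : Matrix (Fin N) (Fin N) ℂ, l2OpNorm M = ‖M‖ := fun M => rfl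
      rw [h, h, h, ← Matrix.l2_opNorm_conjTranspose (Dmat N (fun s u => (starRingEnd ℂ) (b s u)))]
      exact norm_sub_le _ _
    have h4 : 1 / 4 ≤ δ := by
      by_contra hc
      push Not at hc
      have : (N : ℝ) < 16 := by exact_mod_cast hN
      nlinarith [mul_pos hδ hδ]
    have h5 : 0 ≤ Kb * ∑' m, w m := by positivity
    have h6 : 0 ≤ 2 * δ * (L + Kb) + 8 * (∑' m, w m) * δ * L := by positivity
    nlinarith [mul_le_mul_of_nonneg_right h4 h5]
  · set Q := Nat.sqrt N with hQdef
    have hQ1 : Q * Q ≤ N := Nat.sqrt_le N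
    have hQ2 : N < (Q + 1) * (Q + 1) := Nat.lt_succ_sqrt N
    have hQ4 : 4 * Q ≤ N := by
      have : 4 ≤ Q := by rw [hQdef, Nat.le_sqrt]; exact hN
      nlinarith
    have hQ1' : (Q : ℝ) * Q ≤ N := by exact_mod_cast hQ1
    have hQ2' : (N : ℝ) < (Q + 1) * (Q + 1) := by exact_mod_cast hQ2
    have hδQ : 1 ≤ δ * (Q + 1) := by
      by_contra hc
      push Not at hc
      have h0 : 0 ≤ δ * (Q + 1) := by positivity
      have : (δ * (Q + 1)) * (δ * (Q + 1)) < 1 := by nlinarith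
      nlinarith [mul_lt_mul_of_pos_left hQ2' (pow_pos hδ 2)]
    have hδQ' : δ * Q ≤ 1 := by
      by_contra hc
      push Not at hc
      nlinarith [mul_le_mul_of_nonneg_left hQ1' (pow_pos hδ 2).le]
    let σ : ZMod N → UnitAddCircle := fun i => ZMod.toAddCircle i
    have hc : ∀ s, Continuous (b s) := fun s => hb.comp (by fun_prop : Continuous fun u => (s, u))
    have hstep : ∀ (t : ZMod N) u, ‖b (σ t) u - b (σ (t + 1)) u‖ ≤ L / N := by
      intro t u
      refine (hL _ _ u).trans ?_
      rw [div_eq_mul_one_div]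
      refine mul_le_mul_of_nonneg_left ?_ hL0
      rw [dist_comm]
      refine (dist_toAddCircle t (t + 1)).trans ?_
      rw [add_sub_cancel_left]
      have : (1 : ZMod N).valMinAbs = 1 := by
        have := ZMod.valMinAbs_natCast_of_le_half (n := N) (a := 1) (by omega)
        simpa using this
      rw [this]; simp
    have hdiff : ∀ (t : ZMod N) (m : ℤ), fhat b (σ t) m - fhat b (σ (t + 1)) m
        = ∫ u : UnitAddCircle, (b (σ t) u - b (σ (t + 1)) u) * fourier (-m) u := by
      intro t m
      have h1 := hc (σ t)
      have h2 := hc (σ (t + 1))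
      unfold fhat
      rw [← integral_sub (cont_int (by fun_prop)) (cont_int (by fun_prop))]
      simp only [sub_mul]
    have hM1 : Bd (Mp Q fun i m => fhat b (σ i) m) (L / N * Q) := by
      refine Mp_Bd Q _ _ fun t Y Z => ?_
      have := hankel 1 one_ne_zero Q (fun u => b (σ t) u - b (σ (t + 1)) u)
        ((hc _).sub (hc _)) (L / N) (hstep t) Y Z
      simp only [hdiff]
      simpa only [one_mul] using this
    have hM2 : Bd (Mp Q fun i m => fhat b (σ i) (-m)) (L / N * Q) := by
      refine Mp_Bd Q _ _ fun t Y Z => ?_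
      have := hankel (-1) (by norm_num) Q (fun u => b (σ t) u - b (σ (t + 1)) u)
        ((hc _).sub (hc _)) (L / N) (hstep t) Y Z
      simp only [hdiff]
      simpa only [neg_one_mul] using this
    have key := core2 hw hQ4 (fun i m => fhat b (σ i) m) (L / N) Kb δ hKb0 hδ hδQ
      (fun i m => hKb _ m) hM1 hM2
    have hb1 := opNorm_le_of_Bd' (A := Dmat N b - (Dmat N (fun s u => (starRingEnd ℂ) (b s u)))ᴴ)
      (by positivity) _ (fun i j => by
        rw [Matrix.sub_apply, Matrix.conjTranspose_apply, Dmat_eq, Dmat_eq, fhat_conj]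
        simp [σ]) key
    refine hb1.trans ?_
    have e1 : L / N * Q ≤ L * δ := by
      have : L / N * Q = L * δ * (δ * Q) := by
        field_simp
        linear_combination (-L * Q) * hδN
      rw [this]
      exact mul_le_of_le_one_right (by positivity) hδQ'
    have h6 : 0 ≤ δ * Kb + (∑' m, w m) * δ * L + (∑' m, w m) * δ * Kb := by positivity
    have h7 : 0 ≤ (∑' m, w m) * δ * L := by positivity
    have h8 : 0 ≤ (∑' m, w m) * δ * Kb := by positivity
    have h9 : 0 ≤ δ * Kb := by positivity
    nlinarith

/-- Discretization is approximately multiplicative: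
`‖D(a)D(b) − D(ab)‖ ≲ N^{−1/2}(L+‖b‖_α)‖a‖_α`, and similarly with `D(b)*` and `a·b̄`. -/
theorem discretization_mul (α : ℝ) (hα : 2 < α) :
    ∃ C : ℝ, ∀ (N : ℕ) (a b : UnitAddCircle → UnitAddCircle → ℂ),
      Continuous (fun p : UnitAddCircle × UnitAddCircle => a p.1 p.2) →
      Continuous (fun p : UnitAddCircle × UnitAddCircle => b p.1 p.2) →
      ∀ L Ka Kb : ℝ,
        (∀ (s s' u : UnitAddCircle), ‖b s u - b s' u‖ ≤ L * dist s s') →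
        (∀ (s : UnitAddCircle) (k : ℤ), ‖fhat a s k‖ * (1 + |(k : ℝ)|) ^ α ≤ Ka) →
        (∀ (s : UnitAddCircle) (k : ℤ), ‖fhat b s k‖ * (1 + |(k : ℝ)|) ^ α ≤ Kb) →
        l2OpNorm (Dmat N a * Dmat N b - Dmat N (fun s u => a s u * b s u)) ≤
            C * (N : ℝ) ^ (-(1 : ℝ) / 2) * (L + Kb) * Ka ∧
        l2OpNorm (Dmat N a * (Dmat N b)ᴴ -
              Dmat N (fun s u => a s u * (starRingEnd ℂ) (b s u))) ≤
            C * (N : ℝ) ^ (-(1 : ℝ) / 2) * (L + Kb) * Ka := by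
  set w : ℤ → ℝ := fun m : ℤ => (1 + |(m : ℝ)|) ^ (-(α / 2)) with hwdef
  have hw : GoodW w := goodW_rpow hα
  set S := ∑' m, w m with hSdef
  have hS : 0 ≤ S := tsum_nonneg fun m => (hw.pos m).le
  refine ⟨8 * S ^ 2 + S * (2 + 8 * S), ?_⟩
  intro N a b ha hb L Ka Kb hL hKa hKb
  rcases Nat.eq_zero_or_pos N with rfl | hN
  · have hz : ∀ M : Matrix (Fin 0) (Fin 0) ℂ, l2OpNorm M = 0 := fun M => by
      have : M = 0 := Subsingleton.elim _ _
      simp [l2OpNorm, this]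
    rw [hz, hz]
    simp [Real.zero_rpow]
  have : NeZero N := ⟨hN.ne'⟩
  have hNpos : (0 : ℝ) < N := by exact_mod_cast hN
  set δ : ℝ := (N : ℝ) ^ (-(1 : ℝ) / 2) with hδdef
  have hδ : 0 < δ := by positivity
  have hδN : δ ^ 2 * N = 1 := by
    have : δ ^ 2 = (N : ℝ)⁻¹ := by
      rw [hδdef, sq, ← Real.rpow_add hNpos, ← Real.rpow_neg_one]; norm_num
    rw [this, inv_mul_cancel₀ hNpos.ne']
  have hKa0 : 0 ≤ Ka := le_trans (by positivity) (hKa 0 0)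
  have hKb0 : 0 ≤ Kb := le_trans (by positivity) (hKb 0 0)
  have hL0 : 0 ≤ L := by
    have h1 := (norm_nonneg _).trans (hL (((1 / 2 : ℝ)) : UnitAddCircle) 0 0)
    rw [dist_zero_right, AddCircle.norm_half_period_eq] at h1
    norm_num at h1
    exact h1
  have hKa' : ∀ s m, ‖fhat a s m‖ ≤ Ka * w m ^ 2 := fun s m => bound_w _ _ _ (hKa s m)
  have hKb' : ∀ s m, ‖fhat b s m‖ ≤ Kb * w m ^ 2 := fun s m => bound_w _ _ _ (hKb s m)
  have hKb'' : ∀ s m, ‖fhat (fun s u => (starRingEnd ℂ) (b s u)) s m‖ ≤ Kb * w m ^ 2 := by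
    intro s m
    rw [fhat_conj, RCLike.norm_conj]
    have := hKb' s (-m)
    simpa [hwdef] using this
  have hbc : Continuous (fun p : UnitAddCircle × UnitAddCircle => (starRingEnd ℂ) (b p.1 p.2)) :=
    Complex.continuous_conj.comp hb
  have hLc : ∀ (s s' u : UnitAddCircle),
      ‖(starRingEnd ℂ) (b s u) - (starRingEnd ℂ) (b s' u)‖ ≤ L * dist s s' := by
    intro s s' u
    rw [← map_sub, RCLike.norm_conj]
    exact hL s s' u
  have q1 := part1 (N := N) hw ha hb hδ hδN hL0 hKa0 hKb0 hL hKa' hKb'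
  have q2 := part1 (N := N) hw ha (b := fun s u => (starRingEnd ℂ) (b s u)) hbc hδ hδN hL0 hKa0 hKb0
    hLc hKa' hKb''
  have q3 := part2 (N := N) hw hb hδ hδN hL0 hKb0 hL hKb' hKb''
  have q4 := D_norm (N := N) hw hKa0 hKa'
  rw [← hSdef] at q1 q2 q3 q4
  have hpos : 0 ≤ S * (2 + 8 * S) * δ * (L + Kb) * Ka := by positivity
  constructor
  · refine q1.trans ?_
    nlinarith
  · refine (l2_sub_le _ _ (Dmat N (fun s u => (starRingEnd ℂ) (b s u))) _).trans ?_
    have hm := mul_le_mul q4 q3 (norm_nonneg _) (by positivity)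
    nlinarith
end

section
/- Let N∈ℕ, β₁,β₂>1 and set β := min{β₁,β₂}. Then for all A,B∈ℂ^{N×N}: ‖AB‖_β ≤ 2^{β+1}·((β+1)/(β−1))·‖A‖_{β₁}‖B‖_{β₂}. -/
/-- The weighted sup-norm `‖A‖_β := sup_{i,j} |A_{ij}| (1+|i−j|)^β` (as a fold, with value `0`
for the empty matrix). -/
noncomputable def normDecay {N : ℕ} (β : ℝ) (A : Matrix (Fin N) (Fin N) ℂ) : ℝ :=
  Finset.fold max 0
    (fun p : Fin N × Fin N =>
      ‖A p.1 p.2‖ * (1 + |((p.1 : ℕ) : ℝ) - ((p.2 : ℕ) : ℝ)|) ^ β) Finset.univ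

lemma nd_nonneg {N : ℕ} (β : ℝ) (A : Matrix (Fin N) (Fin N) ℂ) : 0 ≤ normDecay β A := by
  unfold normDecay
  rw [Finset.le_fold_max]
  exact Or.inl le_rfl

lemma nd_entry {N : ℕ} (β : ℝ) (A : Matrix (Fin N) (Fin N) ℂ) (i j : Fin N) :
    ‖A i j‖ * (1 + |((i : ℕ) : ℝ) - ((j : ℕ) : ℝ)|) ^ β ≤ normDecay β A := by
  unfold normDecay
  rw [Finset.le_fold_max]
  exact Or.inr ⟨(i, j), Finset.mem_univ _, le_rfl⟩

lemma nd_step (β : ℝ) (hβ : 1 < β) (x : ℝ) (hx : 0 < x) :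
    (β - 1) * (x + 1) ^ (-β) ≤ x ^ (1 - β) - (x + 1) ^ (1 - β) := by
  have hx1 : 0 < x + 1 := by linarith
  have hy : 0 < x / (x + 1) := by positivity
  have h1 : 1 + (β - 1) / (x + 1) ≤ (x / (x + 1)) ^ (1 - β) := by
    rw [Real.rpow_def_of_pos hy]
    have h2 := Real.add_one_le_exp (Real.log (x / (x + 1)) * (1 - β))
    have h3 := Real.log_le_sub_one_of_pos hy
    have h4 : x / (x + 1) - 1 = -(1 / (x + 1)) := by field_simp; ring
    rw [h4] at h3
    have h5 : (β - 1) / (x + 1) = (β - 1) * (1 / (x + 1)) := by ring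
    rw [h5]
    nlinarith
  rw [Real.div_rpow hx.le hx1.le] at h1
  have hp : 0 < (x + 1) ^ (1 - β) := Real.rpow_pos_of_pos hx1 _
  rw [le_div_iff₀ hp] at h1
  have h6 : (x + 1) ^ (1 - β) = (x + 1) * (x + 1) ^ (-β) := by
    rw [sub_eq_add_neg, Real.rpow_add hx1, Real.rpow_one]
  have h7 : (1 + (β - 1) / (x + 1)) * (x + 1) ^ (1 - β)
      = (x + 1) ^ (1 - β) + (β - 1) * (x + 1) ^ (-β) := by
    rw [h6]; field_simp
  linarith

lemma nd_tail (β : ℝ) (hβ : 1 < β) (n : ℕ) :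
    ∑ m ∈ Finset.range n, (1 + ((m : ℝ) + 1)) ^ (-β) ≤ 1 / (β - 1) := by
  have hb : 0 < β - 1 := by linarith
  have key : (β - 1) * ∑ m ∈ Finset.range n, (1 + ((m : ℝ) + 1)) ^ (-β)
      ≤ 1 - ((n : ℝ) + 1) ^ (1 - β) := by
    induction n with
    | zero => simp
    | succ k ih =>
      rw [Finset.sum_range_succ, mul_add]
      have := nd_step β hβ ((k : ℝ) + 1) (by positivity)
      push_cast
      rw [add_comm (1 : ℝ) ((k : ℝ) + 1)]
      linarith
  have hp : 0 ≤ ((n : ℝ) + 1) ^ (1 - β) := Real.rpow_nonneg (by positivity) _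
  rw [le_div_iff₀ hb]
  linarith

lemma nd_sum (β : ℝ) (hβ : 1 < β) (N i : ℕ) :
    ∑ k : Fin N, (1 + |(i : ℝ) - ((k : ℕ) : ℝ)|) ^ (-β) ≤ (β + 1) / (β - 1) := by
  rw [Fin.sum_univ_eq_sum_range (fun k : ℕ => (1 + |(i : ℝ) - (k : ℝ)|) ^ (-β)) N]
  have h1 : ∑ k ∈ Finset.range N, (1 + |(i : ℝ) - (k : ℝ)|) ^ (-β)
      ≤ ∑ k ∈ Finset.range (i + 1 + N), (1 + |(i : ℝ) - (k : ℝ)|) ^ (-β) := by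
    apply Finset.sum_le_sum_of_subset_of_nonneg
    · exact Finset.range_subset_range.2 (by omega)
    · intro k _ _
      exact Real.rpow_nonneg (by positivity) _
  rw [Finset.sum_range_add, Finset.sum_range_succ] at h1
  have h2 : ∑ k ∈ Finset.range i, (1 + |(i : ℝ) - (k : ℝ)|) ^ (-β) ≤ 1 / (β - 1) := by
    rw [← Finset.sum_range_reflect]
    refine le_trans (le_of_eq (Finset.sum_congr rfl ?_)) (nd_tail β hβ i)
    intro k hk
    have hk := Finset.mem_range.1 hk
    have : ((i - 1 - k : ℕ) : ℝ) = (i : ℝ) - 1 - k := by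
      rw [Nat.cast_sub (by omega), Nat.cast_sub (by omega)]; simp
    rw [this]
    have : (i : ℝ) - ((i : ℝ) - 1 - k) = k + 1 := by ring
    rw [this, abs_of_nonneg (by positivity)]
  have h3 : ∑ k ∈ Finset.range N, (1 + |(i : ℝ) - ((i + 1 + k : ℕ) : ℝ)|) ^ (-β)
      ≤ 1 / (β - 1) := by
    refine le_trans (le_of_eq (Finset.sum_congr rfl ?_)) (nd_tail β hβ N)
    intro k _
    push_cast
    have : (i : ℝ) - ((i : ℝ) + 1 + k) = -(k + 1) := by ring
    rw [this, abs_neg, abs_of_nonneg (by positivity)]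
  have h4 : (1 + |(i : ℝ) - (i : ℝ)|) ^ (-β) = 1 := by simp
  have hb : 0 < β - 1 := by linarith
  have h5 : (β + 1) / (β - 1) = 1 / (β - 1) + 1 + 1 / (β - 1) := by field_simp; ring
  rw [h5]
  linarith

lemma nd_two (β x y z : ℝ) (hβ : 0 < β) (hx : 0 < x) (hy : 0 < y) (hz : 0 < z)
    (h : z ≤ x + y) :
    x ^ (-β) * y ^ (-β) * z ^ β ≤ 2 ^ β * (x ^ (-β) + y ^ (-β)) := by
  have aux : ∀ a b : ℝ, 0 < a → 0 < b → a ≤ b → z ≤ a + b →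
      a ^ (-β) * b ^ (-β) * z ^ β ≤ 2 ^ β * a ^ (-β) := by
    intro a b ha hb hab hz'
    have h1 : z ^ β ≤ (2 * b) ^ β := Real.rpow_le_rpow hz.le (by linarith) hβ.le
    rw [Real.mul_rpow (by norm_num) hb.le] at h1
    have h2 : b ^ (-β) * b ^ β = 1 := by rw [← Real.rpow_add hb]; simp
    have hA : 0 < a ^ (-β) := Real.rpow_pos_of_pos ha _
    have hB : 0 < b ^ (-β) := Real.rpow_pos_of_pos hb _
    calc a ^ (-β) * b ^ (-β) * z ^ β ≤ a ^ (-β) * b ^ (-β) * (2 ^ β * b ^ β) := by gcongr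
      _ = 2 ^ β * a ^ (-β) * (b ^ (-β) * b ^ β) := by ring
      _ = _ := by rw [h2, mul_one]
  have hX : 0 < x ^ (-β) := Real.rpow_pos_of_pos hx _
  have hY : 0 < y ^ (-β) := Real.rpow_pos_of_pos hy _
  have h2 : (0:ℝ) < 2 ^ β := Real.rpow_pos_of_pos (by norm_num) _
  rcases le_total x y with hxy | hxy
  · have := aux x y hx hy hxy h
    nlinarith [mul_pos h2 hY]
  · have := aux y x hy hx hxy (by linarith)
    nlinarith [mul_pos h2 hX]

lemma nd_bound {N : ℕ} (β γ : ℝ) (hβ : β ≤ γ) (A : Matrix (Fin N) (Fin N) ℂ) (i j : Fin N) :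
    ‖A i j‖ ≤ normDecay γ A * (1 + |((i : ℕ) : ℝ) - ((j : ℕ) : ℝ)|) ^ (-β) := by
  have h1 : (1:ℝ) ≤ 1 + |((i : ℕ) : ℝ) - ((j : ℕ) : ℝ)| := by
    linarith [abs_nonneg (((i : ℕ) : ℝ) - ((j : ℕ) : ℝ))]
  have h := nd_entry γ A i j
  have h2 := Real.rpow_le_rpow_of_exponent_le h1 hβ
  rw [Real.rpow_neg (by linarith), ← div_eq_mul_inv,
    le_div_iff₀ (Real.rpow_pos_of_pos (by linarith) _)]
  exact le_trans (mul_le_mul_of_nonneg_left h2 (norm_nonneg _)) h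

theorem normDecay_mul_le (N : ℕ) (β₁ β₂ : ℝ) (h₁ : 1 < β₁) (h₂ : 1 < β₂)
    (A B : Matrix (Fin N) (Fin N) ℂ) :
    normDecay (min β₁ β₂) (A * B) ≤
      (2 : ℝ) ^ (min β₁ β₂ + 1) * ((min β₁ β₂ + 1) / (min β₁ β₂ - 1)) *
        (normDecay β₁ A * normDecay β₂ B) := by
  have hβ : 1 < min β₁ β₂ := lt_min h₁ h₂
  have hl := min_le_left β₁ β₂
  have hr := min_le_right β₁ β₂
  generalize min β₁ β₂ = β at *
  have hA := nd_nonneg β₁ A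
  have hB := nd_nonneg β₂ B
  have hb : 0 < β - 1 := by linarith
  have hab := mul_nonneg hA hB
  conv_lhs => unfold normDecay
  rw [Finset.fold_max_le]
  refine ⟨by positivity, ?_⟩
  rintro ⟨i, j⟩ -
  have hz : (0:ℝ) < 1 + |((i : ℕ) : ℝ) - ((j : ℕ) : ℝ)| := by positivity
  have hterm : ∀ k : Fin N, ‖A i k * B k j‖ * (1 + |((i : ℕ) : ℝ) - ((j : ℕ) : ℝ)|) ^ β
      ≤ (normDecay β₁ A * normDecay β₂ B) * (2 ^ β *
        ((1 + |((i : ℕ) : ℝ) - ((k : ℕ) : ℝ)|) ^ (-β)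
          + (1 + |((j : ℕ) : ℝ) - ((k : ℕ) : ℝ)|) ^ (-β))) := by
    intro k
    have hx : (0:ℝ) < 1 + |((i : ℕ) : ℝ) - ((k : ℕ) : ℝ)| := by positivity
    have hy : (0:ℝ) < 1 + |((k : ℕ) : ℝ) - ((j : ℕ) : ℝ)| := by positivity
    have h2 := nd_two β _ _ _ (by linarith) hx hy hz
      (by linarith [abs_sub_le ((i : ℕ) : ℝ) ((k : ℕ) : ℝ) ((j : ℕ) : ℝ)])
    rw [abs_sub_comm ((j : ℕ) : ℝ) ((k : ℕ) : ℝ), norm_mul]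
    have ha := nd_bound β β₁ hl A i k
    have hb := nd_bound β β₂ hr B k j
    have hm := mul_le_mul ha hb (norm_nonneg _) (le_trans (norm_nonneg _) ha)
    refine le_trans (mul_le_mul_of_nonneg_right hm (Real.rpow_nonneg hz.le _)) ?_
    refine le_trans (le_of_eq ?_) (mul_le_mul_of_nonneg_left h2 hab)
    ring
  calc ‖(A * B) i j‖ * (1 + |((i : ℕ) : ℝ) - ((j : ℕ) : ℝ)|) ^ β
      ≤ (∑ k, ‖A i k * B k j‖) * (1 + |((i : ℕ) : ℝ) - ((j : ℕ) : ℝ)|) ^ β := by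
        rw [Matrix.mul_apply]
        exact mul_le_mul_of_nonneg_right (norm_sum_le _ _) (Real.rpow_nonneg hz.le _)
    _ ≤ ∑ k : Fin N, (normDecay β₁ A * normDecay β₂ B) * (2 ^ β *
        ((1 + |((i : ℕ) : ℝ) - ((k : ℕ) : ℝ)|) ^ (-β)
          + (1 + |((j : ℕ) : ℝ) - ((k : ℕ) : ℝ)|) ^ (-β))) := by
        rw [Finset.sum_mul]
        exact Finset.sum_le_sum fun k _ => hterm k
    _ ≤ (normDecay β₁ A * normDecay β₂ B) * (2 ^ β *
        ((β + 1) / (β - 1) + (β + 1) / (β - 1))) := by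
        rw [← Finset.mul_sum, ← Finset.mul_sum, Finset.sum_add_distrib]
        have e1 := nd_sum β hβ N i
        have e2 := nd_sum β hβ N j
        gcongr
    _ = _ := by
        rw [Real.rpow_add (by norm_num), Real.rpow_one]; ring
end

section
/- Let d>1, δ>0, ε∈(0,1) and K>0. There exists a constant C=C(d,δ,ε,K) such that for every N∈ℕ and every A∈ℂ^{N×N} of the form A=I+B with ℓ²→ℓ² operator norm ‖B‖ ≤ 1−ε and with ‖A‖_d ≤ K, the inverse satisfies ‖A^{−1}‖_{d−δ} ≤ C. -/
open scoped Matrix.Norms.L2Operator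

noncomputable def wt {N : ℕ} (i j : Fin N) : ℝ := 1 + |((i : ℕ) : ℝ) - ((j : ℕ) : ℝ)|

def Dec {N : ℕ} (d : ℝ) (A : Matrix (Fin N) (Fin N) ℂ) (a : ℝ) : Prop :=
  ∀ i j, ‖A i j‖ * wt i j ^ d ≤ a

lemma one_le_wt {N : ℕ} (i j : Fin N) : 1 ≤ wt i j := by
  unfold wt; linarith [abs_nonneg (((i : ℕ) : ℝ) - ((j : ℕ) : ℝ))]

lemma wt_pos {N : ℕ} (i j : Fin N) : 0 < wt i j := lt_of_lt_of_le one_pos (one_le_wt i j)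

lemma wt_comm {N : ℕ} (i j : Fin N) : wt i j = wt j i := by
  unfold wt; rw [abs_sub_comm]

lemma normDecay_le_iff {N : ℕ} (d : ℝ) (A : Matrix (Fin N) (Fin N) ℂ) (a : ℝ) :
    normDecay d A ≤ a ↔ 0 ≤ a ∧ Dec d A a := by
  unfold normDecay Dec wt
  rw [Finset.fold_max_le]
  simp

lemma wt_sum_bound (s : ℝ) (hs : 1 < s) : ∃ Z : ℝ, 1 ≤ Z ∧ ∀ (N : ℕ) (i : Fin N),
    ∑ k : Fin N, wt i k ^ (-s) ≤ Z := by
  have hsum : Summable (fun n : ℤ => (1 + |(n : ℝ)|) ^ (-s)) := by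
    have h0 : Summable (fun n : ℕ => (1 + (n : ℝ)) ^ (-s)) := by
      have := (summable_nat_add_iff 1).2 (Real.summable_nat_rpow (p := -s).2 (by linarith))
      refine this.congr fun n => ?_
      push_cast; rw [add_comm]
    refine Summable.of_nat_of_neg ?_ ?_
    · refine h0.congr fun n => ?_
      simp
    · refine h0.congr fun n => ?_
      simp
  refine ⟨(∑' n : ℤ, (1 + |(n : ℝ)|) ^ (-s)) + 1, ?_, ?_⟩
  · have : 0 ≤ ∑' n : ℤ, (1 + |(n : ℝ)|) ^ (-s) := tsum_nonneg fun n => by positivity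
    linarith
  · intro N i
    have hinj : Function.Injective (fun k : Fin N => ((i : ℕ) : ℤ) - ((k : ℕ) : ℤ)) := by
      intro a b h
      ext
      simp only at h
      omega
    have h1 := Summable.sum_le_tsum (Finset.univ.map ⟨_, hinj⟩)
      (fun n _ => by positivity) hsum
    rw [Finset.sum_map] at h1
    simp only [Function.Embedding.coeFn_mk, Int.cast_sub, Int.cast_natCast] at h1
    unfold wt
    linarith

lemma wt_tri {N : ℕ} (d : ℝ) (hd : 0 ≤ d) (i k j : Fin N) :
    wt i j ^ d ≤ 2 ^ d * (wt i k ^ d + wt k j ^ d) := by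
  have h : wt i j ≤ wt i k + wt k j := by
    unfold wt
    have := abs_sub_le ((i : ℕ) : ℝ) ((k : ℕ) : ℝ) ((j : ℕ) : ℝ)
    linarith
  have hp := wt_pos i j
  have h1 := wt_pos i k
  have h2 := wt_pos k j
  rcases le_total (wt i k) (wt k j) with hc | hc
  · calc wt i j ^ d ≤ (2 * wt k j) ^ d := Real.rpow_le_rpow hp.le (by linarith) hd
      _ = 2 ^ d * wt k j ^ d := Real.mul_rpow (by norm_num) h2.le
      _ ≤ _ := by
        gcongr
        have := Real.rpow_nonneg h1.le d
        linarith
  · calc wt i j ^ d ≤ (2 * wt i k) ^ d := Real.rpow_le_rpow hp.le (by linarith) hd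
      _ = 2 ^ d * wt i k ^ d := Real.mul_rpow (by norm_num) h1.le
      _ ≤ _ := by
        gcongr
        have := Real.rpow_nonneg h2.le d
        linarith

lemma dec_mul {N : ℕ} {d s Z : ℝ} (hd : 0 ≤ d)
    (hZ : ∀ i : Fin N, ∑ k : Fin N, wt i k ^ (-s) ≤ Z)
    {A B : Matrix (Fin N) (Fin N) ℂ} {a b α β : ℝ} (ha : 0 ≤ a) (hb : 0 ≤ b)
    (hα : 0 ≤ α) (hβ : 0 ≤ β)
    (hA : Dec d A a) (hB : Dec d B b) (hA' : ∀ i j, ‖A i j‖ ≤ α * wt i j ^ (-s))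
    (hB' : ∀ i j, ‖B i j‖ ≤ β * wt i j ^ (-s)) :
    Dec d (A * B) (2 ^ d * Z * (a * β + b * α)) := by
  intro i j
  have hw := Real.rpow_nonneg (wt_pos i j).le d
  calc ‖(A * B) i j‖ * wt i j ^ d
      ≤ (∑ k, ‖A i k‖ * ‖B k j‖) * wt i j ^ d := by
        gcongr
        rw [Matrix.mul_apply]
        refine (norm_sum_le _ _).trans (le_of_eq ?_)
        simp
    _ = ∑ k, ‖A i k‖ * ‖B k j‖ * wt i j ^ d := Finset.sum_mul _ _ _
    _ ≤ ∑ k, 2 ^ d * (a * (β * wt j k ^ (-s)) + b * (α * wt i k ^ (-s))) := by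
        refine Finset.sum_le_sum fun k _ => ?_
        calc ‖A i k‖ * ‖B k j‖ * wt i j ^ d
            ≤ ‖A i k‖ * ‖B k j‖ * (2 ^ d * (wt i k ^ d + wt k j ^ d)) := by
              gcongr
              exact wt_tri d hd i k j
          _ = 2 ^ d * ((‖A i k‖ * wt i k ^ d) * ‖B k j‖
                + (‖B k j‖ * wt k j ^ d) * ‖A i k‖) := by ring
          _ ≤ _ := by
              gcongr
              · exact hA i k
              · rw [wt_comm j k]; exact hB' k j
              · exact hB k j
              · exact hA' i k
    _ = 2 ^ d * (a * β * (∑ k, wt j k ^ (-s)) + b * α * (∑ k, wt i k ^ (-s))) := by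
        rw [← Finset.mul_sum, Finset.sum_add_distrib]
        simp only [Finset.mul_sum, mul_assoc]
    _ ≤ 2 ^ d * (a * β * Z + b * α * Z) := by
        gcongr
        · exact hZ j
        · exact hZ i
    _ = _ := by ring

lemma dec_point {N : ℕ} {d s : ℝ} (hs : s ≤ d)
    {A : Matrix (Fin N) (Fin N) ℂ} {a : ℝ} (ha : 0 ≤ a) (hA : Dec d A a) (i j : Fin N) :
    ‖A i j‖ ≤ a * wt i j ^ (-s) := by
  have hw := wt_pos i j
  have h1 : ‖A i j‖ ≤ a * wt i j ^ (-d) := by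
    rw [Real.rpow_neg hw.le, ← div_eq_mul_inv, le_div_iff₀ (Real.rpow_pos_of_pos hw d)]
    exact hA i j
  refine h1.trans ?_
  gcongr
  exact one_le_wt i j

lemma dec_interp {N : ℕ} {d s : ℝ} (hs0 : 0 < s) (hs : s ≤ d)
    {A : Matrix (Fin N) (Fin N) ℂ} {a q : ℝ} (ha : 0 ≤ a) (hA : Dec d A a)
    (hq : ∀ i j, ‖A i j‖ ≤ q) (i j : Fin N) :
    ‖A i j‖ ≤ q ^ (1 - s / d) * a ^ (s / d) * wt i j ^ (-s) := by
  have hw := wt_pos i j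
  have hd : 0 < d := by linarith
  have h1 := dec_point le_rfl ha hA i j
  have hx := norm_nonneg (A i j)
  have ht : s / d ≤ 1 := (div_le_one hd).2 hs
  have ht0 : 0 < s / d := by positivity
  calc ‖A i j‖ = ‖A i j‖ ^ (1 - s / d) * ‖A i j‖ ^ (s / d) := by
        rw [← Real.rpow_add_of_nonneg hx (by linarith) ht0.le]; simp
    _ ≤ q ^ (1 - s / d) * (a * wt i j ^ (-d)) ^ (s / d) := by
        have hq0 : 0 ≤ q := hx.trans (hq i j)
        have : 0 ≤ 1 - s / d := by linarith
        gcongr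
        exact hq i j
    _ = _ := by
        rw [Real.mul_rpow ha (by positivity), ← Real.rpow_mul hw.le, mul_assoc]
        congr 3
        field_simp

lemma entry_le_norm {N : ℕ} (A : Matrix (Fin N) (Fin N) ℂ) (i j : Fin N) : ‖A i j‖ ≤ ‖A‖ := by
  have h := Matrix.l2_opNorm_mulVec A (EuclideanSpace.single j (1 : ℂ))
  simp only [EuclideanSpace.norm_single, norm_one, mul_one] at h
  refine le_trans ?_ h
  refine le_trans (le_of_eq ?_) (PiLp.norm_apply_le _ i)
  simp

lemma dec_one {N : ℕ} (d : ℝ) : Dec d (1 : Matrix (Fin N) (Fin N) ℂ) 1 := by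
  intro i j
  by_cases h : i = j
  · subst h; simp [wt]
  · simp [Matrix.one_apply_ne h]

lemma dec_add {N : ℕ} {d : ℝ} {A B : Matrix (Fin N) (Fin N) ℂ} {a b : ℝ}
    (hA : Dec d A a) (hB : Dec d B b) : Dec d (A + B) (a + b) := by
  intro i j
  have := Real.rpow_nonneg (wt_pos i j).le d
  calc ‖(A + B) i j‖ * wt i j ^ d ≤ (‖A i j‖ + ‖B i j‖) * wt i j ^ d := by
        gcongr; exact norm_add_le _ _
    _ ≤ _ := by rw [add_mul]; exact add_le_add (hA i j) (hB i j)

lemma dec_neg {N : ℕ} {d : ℝ} {A : Matrix (Fin N) (Fin N) ℂ} {a : ℝ}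
    (hA : Dec d A a) : Dec d (-A) a := by
  intro i j
  simpa using hA i j

lemma dec_mono {N : ℕ} {d : ℝ} {A : Matrix (Fin N) (Fin N) ℂ} {a b : ℝ}
    (hA : Dec d A a) (h : a ≤ b) : Dec d A b := fun i j => (hA i j).trans h

lemma norm_pow_two_pow {N : ℕ} {T : Matrix (Fin N) (Fin N) ℂ} {q : ℝ} (h : ‖T‖ ≤ q) (k : ℕ) :
    ‖T ^ (2 ^ k)‖ ≤ q ^ (2 ^ k) :=
  (norm_pow_le' T (by positivity)).trans (pow_le_pow_left₀ (norm_nonneg _) h _)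

lemma unit_one_sub {N : ℕ} {T : Matrix (Fin N) (Fin N) ℂ} {q : ℝ} (hq0 : 0 < q) (hq1 : q < 1)
    (h : ‖T‖ ≤ q) (k : ℕ) : IsUnit (1 - T ^ (2 ^ k)).det := by
  rw [← Matrix.isUnit_iff_isUnit_det]
  apply isUnit_one_sub_of_norm_lt_one
  exact (norm_pow_two_pow h k).trans_lt (pow_lt_one₀ hq0.le hq1 (by positivity))

/-- explicit bound for the decay norm of the power `2^k` -/
noncomputable def EE (c e t l : ℝ) (k : ℕ) : ℝ := Real.exp (c * t ^ k - e + 2 ^ k * l)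

lemma EE_tendsto (c e t l : ℝ) (ht0 : 0 < t) (ht : t < 2) (hl : l < 0) :
    Filter.Tendsto (EE c e t l) Filter.atTop (nhds 0) := by
  unfold EE
  apply Real.tendsto_exp_atBot.comp
  have h1 : Filter.Tendsto (fun k : ℕ => c * (t / 2) ^ k + l) Filter.atTop (nhds l) := by
    have := (tendsto_pow_atTop_nhds_zero_of_lt_one (r := t / 2) (by positivity)
      (by linarith)).const_mul c
    simpa using this.add_const l
  have h2 : Filter.Tendsto (fun k : ℕ => (2 : ℝ) ^ k) Filter.atTop Filter.atTop :=
    tendsto_pow_atTop_atTop_of_one_lt (by norm_num)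
  have h3 := Filter.tendsto_atBot_add_const_right _ (-e) (h2.atTop_mul_neg hl h1)
  refine h3.congr fun k => ?_
  rw [div_pow]
  field_simp
  ring

lemma EE_succ (c G θ q : ℝ) (hG : 0 < G) (hθ : 0 < θ) (hq : 0 < q) (k : ℕ) :
    G * (EE c (Real.log G / θ) (1 + θ) (Real.log q) k *
      ((q ^ (2 ^ k)) ^ (1 - θ) * EE c (Real.log G / θ) (1 + θ) (Real.log q) k ^ θ)) =
    EE c (Real.log G / θ) (1 + θ) (Real.log q) (k + 1) := by
  have h1 : (q ^ (2 ^ k)) ^ (1 - θ) = Real.exp (2 ^ k * Real.log q * (1 - θ)) := by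
    rw [Real.exp_mul, ← Real.exp_log (pow_pos hq (2 ^ k)), Real.log_pow]
    push_cast; rfl
  rw [h1]
  unfold EE
  nth_rewrite 1 [← Real.exp_log hG]
  rw [← Real.exp_mul, ← Real.exp_add, ← Real.exp_add, ← Real.exp_add]
  congr 1
  field_simp
  ring

/-- For `d > 1`, `δ > 0`, `ε ∈ (0,1)`, `K > 0` there is `C = C(d,δ,ε,K)`
such that for every `A = I + B` with `‖B‖ ≤ 1−ε` and `‖A‖_d ≤ K`: `‖A⁻¹‖_{d−δ} ≤ C`. -/
theorem inverse_norm_decay_of_decay_unif (d δ ε K : ℝ) (hd : 1 < d) (hδ : 0 < δ)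
    (hε : 0 < ε) (hε1 : ε < 1) (hK : 0 < K) :
    ∃ C : ℝ, ∀ (N : ℕ) (B : Matrix (Fin N) (Fin N) ℂ),
      l2OpNorm B ≤ 1 - ε → normDecay d (1 + B) ≤ K →
        normDecay (d - δ) (1 + B)⁻¹ ≤ C := by
  obtain ⟨q, hqdef⟩ : ∃ q, q = 1 - ε := ⟨_, rfl⟩
  have hq0 : 0 < q := by linarith
  have hq1 : q < 1 := by linarith
  obtain ⟨s, hsdef⟩ : ∃ s, s = (1 + d) / 2 := ⟨_, rfl⟩
  have hs1 : 1 < s := by linarith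
  have hsd : s < d := by linarith
  obtain ⟨θ, hθ⟩ : ∃ θ, θ = s / d := ⟨_, rfl⟩
  have hθ0 : 0 < θ := by rw [hθ]; exact div_pos (by linarith) (by linarith)
  have hθ1 : θ < 1 := by rw [hθ]; exact (div_lt_one (by linarith)).2 hsd
  obtain ⟨Z, hZ1, hZ⟩ := wt_sum_bound s hs1
  obtain ⟨G, hGdef⟩ : ∃ G : ℝ, G = 2 ^ d * Z * 2 := ⟨_, rfl⟩
  have hG : 0 < G := by rw [hGdef]; positivity
  have hl : Real.log q < 0 := Real.log_neg hq0 hq1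
  obtain ⟨E, hE⟩ : ∃ E, E = EE (Real.log (K + 1) + Real.log G / θ - Real.log q)
    (Real.log G / θ) (1 + θ) (Real.log q) := ⟨_, rfl⟩
  have hEpos : ∀ k, 0 < E k := fun k => by rw [hE]; exact Real.exp_pos _
  have hE0 : E 0 = K + 1 := by
    rw [hE]; unfold EE
    simp only [pow_zero]
    convert Real.exp_log (show 0 < K + 1 by linarith) using 2
    ring
  have hEs : ∀ k, G * (E k * ((q ^ (2 ^ k)) ^ (1 - θ) * E k ^ θ)) = E (k + 1) := by
    intro k; rw [hE]; exact EE_succ _ _ _ _ hG hθ0 hq0 k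
  -- multiplication
  have hmul : ∀ (N : ℕ) (A B : Matrix (Fin N) (Fin N) ℂ) (a b : ℝ), 0 ≤ a → 0 ≤ b →
      Dec d A a → Dec d B b → Dec d (A * B) (G * (a * b)) := by
    intro N A B a b ha hb hA hB
    refine dec_mono (dec_mul (by linarith) (hZ N) ha hb ha hb hA hB (dec_point hsd.le ha hA)
      (dec_point hsd.le hb hB)) (le_of_eq ?_)
    rw [hGdef]; ring
  -- powers
  have hpow : ∀ (N : ℕ) (T : Matrix (Fin N) (Fin N) ℂ), ‖T‖ ≤ q → Dec d T (K + 1) →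
      ∀ k, Dec d (T ^ (2 ^ k)) (E k) := by
    intro N T hT hTd k
    induction k with
    | zero => simpa [hE0] using hTd
    | succ k ih =>
      rw [pow_succ, pow_mul, sq, ← hEs]
      have hp := dec_interp (by linarith) hsd.le (hEpos k).le ih
        (fun i j => (entry_le_norm _ i j).trans (norm_pow_two_pow hT k))
      rw [← hθ] at hp
      have hα : 0 ≤ (q ^ (2 ^ k)) ^ (1 - θ) * E k ^ θ := by
        have := hEpos k
        positivity
      refine dec_mono (dec_mul (by linarith) (hZ N) (hEpos k).le (hEpos k).le hα hα ih ih hp hp)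
        (le_of_eq ?_)
      rw [hGdef]; ring
  -- a good power
  obtain ⟨k₀, hk₀⟩ : ∃ k, E k < 1 / (2 * G) := by
    have := EE_tendsto (Real.log (K + 1) + Real.log G / θ - Real.log q)
      (Real.log G / θ) (1 + θ) (Real.log q) (by linarith) (by linarith) hl
    rw [← hE] at this
    exact (this.eventually (gt_mem_nhds (by positivity))).exists
  have hinv0 : ∀ (N : ℕ) (T : Matrix (Fin N) (Fin N) ℂ), ‖T‖ ≤ q → Dec d T (K + 1) →
      Dec d (1 - T ^ (2 ^ k₀))⁻¹ 2 := by
    intro N T hT hTd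
    have hu := unit_one_sub hq0 hq1 hT k₀
    set P := T ^ (2 ^ k₀) with hP
    set X := (1 - P)⁻¹ with hX
    have hXe : X = 1 + P * X := by
      have := Matrix.mul_nonsing_inv _ hu
      rw [← hX, sub_mul, one_mul] at this
      rw [← this]; abel
    obtain ⟨hx0, hx⟩ := (normDecay_le_iff d X (normDecay d X)).1 le_rfl
    have h1 : Dec d X (1 + G * (E k₀ * normDecay d X)) := by
      have := dec_add (dec_one d) (hmul N P X _ _ (hEpos k₀).le hx0 (hpow N T hT hTd k₀) hx)
      rwa [← hXe] at this
    have h2 : normDecay d X ≤ 1 + G * (E k₀ * normDecay d X) :=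
      (normDecay_le_iff _ _ _).2 ⟨by have := hEpos k₀; positivity, h1⟩
    have h3 : G * E k₀ ≤ 1 / 2 := by
      rw [lt_div_iff₀ (by positivity)] at hk₀
      linarith
    refine dec_mono hx ?_
    nlinarith
  -- going back
  have hback : ∀ k, ∀ M : ℝ, 0 ≤ M → ∃ C : ℝ, 0 ≤ C ∧
      ∀ (N : ℕ) (T : Matrix (Fin N) (Fin N) ℂ), ‖T‖ ≤ q →
      Dec d T (K + 1) → Dec d (1 - T ^ (2 ^ k))⁻¹ M → Dec d (1 - T)⁻¹ C := by
    intro k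
    induction k with
    | zero => intro M hM; exact ⟨M, hM, fun N T _ _ h => by simpa using h⟩
    | succ k ih =>
      intro M hM
      obtain ⟨C, hC, h⟩ := ih (G * ((1 + E k) * M)) (by have := hEpos k; positivity)
      refine ⟨C, hC, fun N T hT hTd hM' => h N T hT hTd ?_⟩
      have hu := unit_one_sub hq0 hq1 hT (k + 1)
      have he : (1 - T ^ (2 ^ k))⁻¹ = (1 + T ^ (2 ^ k)) * (1 - T ^ (2 ^ (k + 1)))⁻¹ := by
        apply Matrix.inv_eq_right_inv
        rw [← mul_assoc]
        have : (1 - T ^ (2 ^ k)) * (1 + T ^ (2 ^ k)) = 1 - T ^ (2 ^ (k + 1)) := by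
          rw [pow_succ 2 k, pow_mul T, sq]; noncomm_ring
        rw [this, Matrix.mul_nonsing_inv _ hu]
      rw [he]
      exact hmul N _ _ _ _ (by have := hEpos k; positivity) hM
        (dec_add (dec_one d) (hpow N T hT hTd k)) hM'
  obtain ⟨C, hC, h⟩ := hback k₀ 2 (by norm_num)
  refine ⟨C, fun N B hB hBd => ?_⟩
  have hBq : ‖-B‖ ≤ q := by
    rw [norm_neg, hqdef]; exact hB
  have hBdec : Dec d (-B) (K + 1) := by
    have := dec_add (dec_neg ((normDecay_le_iff _ _ _).1 hBd).2) (dec_one d)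
    rwa [show -(1 + B) + 1 = -B by abel] at this
  have hfin := h N (-B) hBq hBdec (hinv0 N (-B) hBq hBdec)
  rw [sub_neg_eq_add] at hfin
  refine (normDecay_le_iff _ _ _).2 ⟨hC, fun i j => le_trans ?_ (hfin i j)⟩
  gcongr
  · exact one_le_wt i j
  · linarith
end
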